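/- arXiv:1204.1272 — 4 statements merged into one kernel-verified Lean document; each statement's English description precedes it below -/
import Mathlib

section
/- For every n ≥ 1, the number of monotonic trees on the vertex set {1,2,…,n} is (n−1)!. -/
/-- A tree on the vertex set `Fin n` (representing `{1,…,n}`) is *monotonic* if for every
vertex `v`, the vertices along any path from the vertex `0` (representing `1`) to `v`
form a strictly increasing sequence. -/
def SimpleGraph.IsMonotonicTree {n : ℕ} (hn : 1 ≤ n) (G : SimpleGraph (Fin n)) : Prop :=
  G.IsTree ∧ ∀ (v : Fin n) (p : G.Walk ⟨0, hn⟩ v), p.IsPath → p.support.Chain' (· < ·)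

namespace SimpleGraph

variable {m : ℕ} {G : SimpleGraph (Fin (m + 1))}

theorem Walk.penultimate_lt_of_isChain_support {u v : Fin (m + 1)} {p : G.Walk u v}
    (hnil : ¬ p.Nil) (hp : p.support.IsChain (· < ·)) : p.penultimate < v := by
  rw [← p.concat_dropLast (p.adj_penultimate hnil), Walk.support_concat,
    ← p.dropLast.dropLast_support_concat] at hp
  simp only [List.append_assoc] at hp
  simpa using hp.right_of_append

/-- In a monotonic tree, the penultimate vertex of the path from the root to `v` is the only
neighbour of `v` that is smaller than `v`. -/
theorem IsMonotonicTree.existsUnique_lt_adj (hG : G.IsMonotonicTree m.succ_pos)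
    {v : Fin (m + 1)} (hv : v ≠ 0) : ∃! u, u < v ∧ G.Adj u v := by
  obtain ⟨hT, hmono⟩ := hG
  have isChain_support (w : Fin (m + 1)) (p : G.Walk 0 w) (hp : p.IsPath) :
      p.support.IsChain (· < ·) := hmono w p hp
  obtain ⟨p, hp, hpu⟩ := hT.existsUnique_path 0 v
  have eq_penultimate (u : Fin (m + 1)) (huv : u < v) (hadj : G.Adj u v) :
      u = p.penultimate := by
    obtain ⟨q, hq, -⟩ := hT.existsUnique_path 0 u
    have hvq : v ∉ q.support := by
      intro hvq
      have hsorted := (isChain_support u q hq).pairwise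
      rw [← q.dropLast_support_concat, List.pairwise_append] at hsorted
      rw [← q.dropLast_support_concat, List.mem_append] at hvq
      rcases hvq with h | h
      · exact (hsorted.2.2 v h u (by simp)).not_gt huv
      · simp at h
        exact huv.ne h.symm
    rw [← hpu (q.concat hadj) (hq.concat hvq hadj), Walk.penultimate_concat]
  have hnil : ¬ p.Nil := Walk.not_nil_of_ne hv.symm
  exact ⟨p.penultimate, ⟨Walk.penultimate_lt_of_isChain_support hnil (isChain_support v p hp),
    p.adj_penultimate hnil⟩, fun u hu => eq_penultimate u hu.1 hu.2⟩

theorem connected_of_forall_exists_lt_adj (h : ∀ v : Fin (m + 1), v ≠ 0 → ∃ u < v, G.Adj u v) :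
    G.Connected := by
  have reachable_zero (v : Fin (m + 1)) : G.Reachable 0 v := by
    induction v using WellFoundedLT.induction with
    | ind v ih =>
      by_cases hv : v = 0
      · rw [hv]
      · obtain ⟨u, huv, hadj⟩ := h v hv
        exact (ih u huv).trans hadj.reachable
  exact (connected_iff _).2 ⟨fun u v => (reachable_zero u).symm.trans (reachable_zero v), ⟨0⟩⟩

theorem isTree_of_forall_existsUnique_lt_adj
    (h : ∀ v : Fin (m + 1), v ≠ 0 → ∃! u, u < v ∧ G.Adj u v) : G.IsTree := by
  have hconn : G.Connected := connected_of_forall_exists_lt_adj fun v hv => (h v hv).exists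
  refine isTree_iff_connected_and_card.2 ⟨hconn, le_antisymm ?_
    hconn.card_vert_le_card_edgeSet_add_one⟩
  choose f hf hfu using fun i : Fin m => h i.succ i.succ_ne_zero
  have mem_range (u v : Fin (m + 1)) (huv : u < v) (hadj : G.Adj u v) :
      s(u, v) ∈ Set.range fun i => s(f i, i.succ) := by
    obtain ⟨i, rfl⟩ := Fin.exists_succ_eq.2 (Fin.ne_zero_of_lt huv)
    exact ⟨i, by rw [hfu i u ⟨huv, hadj⟩]⟩
  have hsub : G.edgeSet ⊆ Set.range fun i => s(f i, i.succ) := by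
    intro e
    induction e with
    | _ u v =>
      intro hadj
      rw [mem_edgeSet] at hadj
      rcases hadj.ne.lt_or_gt with huv | huv
      · exact mem_range u v huv hadj
      · rw [Sym2.eq_swap]
        exact mem_range v u huv hadj.symm
  have hcard : Nat.card G.edgeSet ≤ Nat.card (Fin m) :=
    (Nat.card_mono (Set.finite_range _) hsub).trans (Finite.card_range_le _)
  simpa using hcard

theorem Walk.IsPath.isChain_support_of_forall_existsUnique_lt_adj
    (h : ∀ v : Fin (m + 1), v ≠ 0 → ∃! u, u < v ∧ G.Adj u v) {v : Fin (m + 1)} {p : G.Walk 0 v}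
    (hp : p.IsPath) : p.support.IsChain (· < ·) := by
  suffices ∀ (u v : Fin (m + 1)) (p : G.Walk u v), u = 0 → p.IsPath →
      p.support.IsChain (· < ·) from this 0 v p rfl hp
  intro u v p
  induction p using Walk.concatRec with
  | Hnil => simp
  | @Hconcat r u v p hadj ih =>
    rintro rfl hp
    have hp' := (Walk.concat_isPath_iff hadj).1 hp
    have hchain := ih rfl hp'.1
    have huv : u < v := by
      refine hadj.ne.lt_or_gt.resolve_right fun hvu => hp'.2 ?_
      have hnil : ¬ p.Nil := Walk.not_nil_of_ne (Fin.ne_zero_of_lt hvu).symm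
      have hlt := Walk.penultimate_lt_of_isChain_support hnil hchain
      rw [(h u (Fin.ne_zero_of_lt hvu)).unique ⟨hvu, hadj.symm⟩ ⟨hlt, p.adj_penultimate hnil⟩]
      exact p.getVert_mem_support _
    rw [Walk.support_concat, List.isChain_append]
    refine ⟨hchain, by simp, ?_⟩
    simpa [List.getLast?_eq_some_getLast p.support_ne_nil] using huv

/-- A graph on `Fin (m + 1)` is a monotonic tree exactly when every vertex other than `0` has a
unique smaller neighbour. -/
theorem isMonotonicTree_iff_forall_existsUnique_lt_adj :
    G.IsMonotonicTree m.succ_pos ↔ ∀ v : Fin (m + 1), v ≠ 0 → ∃! u, u < v ∧ G.Adj u v :=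
  ⟨fun hG _ hv => hG.existsUnique_lt_adj hv, fun h =>
    ⟨isTree_of_forall_existsUnique_lt_adj h,
      fun _ _ hp => hp.isChain_support_of_forall_existsUnique_lt_adj h⟩⟩

/-- The graph on `Fin (m + 1)` in which each vertex `i + 1` is joined to its parent `f i ≤ i`. -/
def parentGraph (f : (i : Fin m) → Fin (i + 1)) : SimpleGraph (Fin (m + 1)) :=
  fromRel fun u v => ∃ i, u.val = (f i).val ∧ v = i.succ

theorem parentGraph_adj_succ_of_lt {f : (i : Fin m) → Fin (i + 1)} {u : Fin (m + 1)} {i : Fin m}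
    (hu : u < i.succ) : (parentGraph f).Adj u i.succ ↔ u.val = (f i).val := by
  simp only [parentGraph, fromRel_adj]
  refine ⟨?_, fun h => ⟨hu.ne, Or.inl ⟨i, h, rfl⟩⟩⟩
  rintro ⟨-, ⟨j, huj, hij⟩ | ⟨j, hij, rfl⟩⟩
  · rwa [Fin.succ_injective _ hij]
  · have := (f j).isLt
    rw [Fin.lt_def] at hu
    simp only [Fin.val_succ] at hu hij
    omega

theorem isMonotonicTree_parentGraph (f : (i : Fin m) → Fin (i + 1)) :
    (parentGraph f).IsMonotonicTree m.succ_pos := by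
  refine isMonotonicTree_iff_forall_existsUnique_lt_adj.2 fun v hv => ?_
  obtain ⟨i, rfl⟩ := Fin.exists_succ_eq.2 hv
  have hlt : (f i).castLE (by omega) < i.succ := Fin.lt_def.2 (f i).isLt
  exact ⟨(f i).castLE (by omega), ⟨hlt, (parentGraph_adj_succ_of_lt hlt).2 rfl⟩,
    fun u hu => Fin.ext ((parentGraph_adj_succ_of_lt hu.1).1 hu.2)⟩

theorem parentGraph_injective :
    Function.Injective (parentGraph : ((i : Fin m) → Fin (i + 1)) → _) := by
  intro f g hfg
  funext i
  have hlt : (f i).castLE (by omega) < i.succ := Fin.lt_def.2 (f i).isLt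
  have hadj : (parentGraph f).Adj _ i.succ := (parentGraph_adj_succ_of_lt hlt).2 rfl
  rw [hfg] at hadj
  exact Fin.ext ((parentGraph_adj_succ_of_lt hlt).1 hadj)

theorem IsMonotonicTree.exists_parentGraph_eq (hG : G.IsMonotonicTree m.succ_pos) :
    ∃ f, parentGraph f = G := by
  choose f hf hfu using fun i : Fin m => hG.existsUnique_lt_adj i.succ_ne_zero
  refine ⟨fun i => ⟨(f i).val, Fin.lt_def.1 (hf i).1⟩, ?_⟩
  have adj_iff (u v : Fin (m + 1)) (huv : u < v) :
      (parentGraph fun i => ⟨(f i).val, Fin.lt_def.1 (hf i).1⟩).Adj u v ↔ G.Adj u v := by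
    obtain ⟨i, rfl⟩ := Fin.exists_succ_eq.2 (Fin.ne_zero_of_lt huv)
    rw [parentGraph_adj_succ_of_lt huv, ← Fin.ext_iff]
    exact ⟨fun h => h ▸ (hf i).2, fun h => hfu i u ⟨huv, h⟩⟩
  ext u v
  rcases lt_trichotomy u v with huv | rfl | huv
  · exact adj_iff u v huv
  · simp
  · rw [adj_comm, adj_iff v u huv, adj_comm]

end SimpleGraph

/-- For every `n ≥ 1`, the number of monotonic trees on the vertex set `{1,2,…,n}`
is `(n-1)!`. -/
theorem card_monotonic_trees (n : ℕ) (hn : 1 ≤ n) :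
    Nat.card {G : SimpleGraph (Fin n) // G.IsMonotonicTree hn} = (n - 1).factorial := by
  obtain ⟨m, rfl⟩ := Nat.exists_eq_add_of_le' hn
  have hbij : Function.Bijective fun f : (i : Fin m) → Fin (i + 1) =>
      (⟨SimpleGraph.parentGraph f, SimpleGraph.isMonotonicTree_parentGraph f⟩ :
        {G : SimpleGraph (Fin (m + 1)) // G.IsMonotonicTree hn}) :=
    ⟨fun _ _ h => SimpleGraph.parentGraph_injective (congrArg Subtype.val h),
      fun ⟨_, hG⟩ => hG.exists_parentGraph_eq.imp fun _ h => Subtype.ext h⟩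
  rw [← Nat.card_eq_of_bijective _ hbij, Nat.card_pi]
  simp only [Nat.card_fin, Nat.add_sub_cancel]
  rw [Fin.prod_univ_eq_prod_range (fun i => i + 1) m, Finset.prod_range_add_one_eq_factorial]
end

section
/- For n ≥ 2, the Arnold differential algebra (A(n), ∂) is an exact chain complex: ∂ ∘ ∂ = 0, and for every q the kernel of ∂: A^q(n) → A^{q−1}(n) equals the image of ∂: A^{q+1}(n) → A^q(n) (where A^q(n) = 0 for q < 0 and q > n−1); in particular all homology groups of (A(n), ∂) vanish. An explicit contracting homotopy is h(γ) = G_{12}·γ, which satisfies ∂h + h∂ = id. -/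
/-- Index type for the generators `G_{ij}`, `i < j`, of the Arnold algebra. -/
abbrev ArnoldPairs (n : ℕ) := {p : Fin n × Fin n // p.1 < p.2}

/-- The free `ℚ`-module on the generators. -/
abbrev ArnoldGenModule (n : ℕ) := ArnoldPairs n →₀ ℚ

/-- The degree-one generator `G_{ij}` (for `i < j`) inside the exterior algebra. -/
noncomputable def arnoldGen0 (n : ℕ) (i j : Fin n) (h : i < j) :
    ExteriorAlgebra ℚ (ArnoldGenModule n) :=
  ExteriorAlgebra.ι ℚ (Finsupp.single ⟨(i, j), h⟩ 1)

/-- The Arnold relations `G_{ij}G_{ik} - G_{ij}G_{jk} + G_{ik}G_{jk} = 0` for `i < j < k`. -/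
inductive ArnoldRel (n : ℕ) :
    ExteriorAlgebra ℚ (ArnoldGenModule n) → ExteriorAlgebra ℚ (ArnoldGenModule n) → Prop
  | rel {i j k : Fin n} (hij : i < j) (hjk : j < k) :
      ArnoldRel n
        (arnoldGen0 n i j hij * arnoldGen0 n i k (hij.trans hjk)
          - arnoldGen0 n i j hij * arnoldGen0 n j k hjk
          + arnoldGen0 n i k (hij.trans hjk) * arnoldGen0 n j k hjk) 0

/-- The Arnold algebra `A(n)`. -/
abbrev ArnoldAlgebra (n : ℕ) := RingQuot (ArnoldRel n)

/-- The generator `G_{ij}` in the Arnold algebra, with the convention `G_{ji} = G_{ij}`. -/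
noncomputable def ArnoldG {n : ℕ} (i j : Fin n) : ArnoldAlgebra n :=
  if h : i < j then RingQuot.mkAlgHom ℚ (ArnoldRel n) (arnoldGen0 n i j h)
  else if h' : j < i then RingQuot.mkAlgHom ℚ (ArnoldRel n) (arnoldGen0 n j i h')
  else 0

/-- The grading `A^q(n)` of the Arnold algebra by the number of generators: the image in
the quotient of the `q`-th exterior power part of the exterior algebra. -/
noncomputable def ArnoldGrade (n q : ℕ) : Submodule ℚ (ArnoldAlgebra n) :=
  Submodule.map (RingQuot.mkAlgHom ℚ (ArnoldRel n)).toLinearMap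
    (LinearMap.range (ExteriorAlgebra.ι ℚ (M := ArnoldGenModule n)) ^ q)

/-- The canonical image in `A(n)` of a vector of the generating module. -/
noncomputable def arnoldVec {n : ℕ} (v : ArnoldGenModule n) : ArnoldAlgebra n :=
  RingQuot.mkAlgHom ℚ (ArnoldRel n) (ExteriorAlgebra.ι ℚ v)

theorem arnoldVec_mem_grade_one {n : ℕ} (v : ArnoldGenModule n) :
    arnoldVec v ∈ ArnoldGrade n 1 :=
  Submodule.mem_map.mpr ⟨ExteriorAlgebra.ι ℚ v, by simp, rfl⟩

theorem arnoldG_eq_arnoldVec {n : ℕ} {i j : Fin n} (h : i < j) :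
    ArnoldG i j = arnoldVec (Finsupp.single ⟨(i, j), h⟩ 1) := by
  simp [ArnoldG, h, arnoldGen0, arnoldVec]

theorem one_mem_arnoldGrade_zero (n : ℕ) : (1 : ArnoldAlgebra n) ∈ ArnoldGrade n 0 :=
  Submodule.mem_map.mpr ⟨1, by rw [pow_zero]; exact Submodule.one_le.mp le_rfl,
    map_one (RingQuot.mkAlgHom ℚ (ArnoldRel n))⟩

theorem arnoldVec_mul_mem_grade {n q : ℕ} (v : ArnoldGenModule n) {x : ArnoldAlgebra n}
    (hx : x ∈ ArnoldGrade n q) : arnoldVec v * x ∈ ArnoldGrade n (q + 1) := by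
  obtain ⟨y, hy, rfl⟩ := Submodule.mem_map.mp hx
  refine Submodule.mem_map.mpr ⟨ExteriorAlgebra.ι ℚ v * y, ?_,
    map_mul (RingQuot.mkAlgHom ℚ (ArnoldRel n)) _ _⟩
  rw [pow_succ']
  exact Submodule.mul_mem_mul (LinearMap.mem_range_self _ v) hy

/-- A linear map sending each generator to `1` sends every degree-one vector to a scalar. -/
theorem exists_map_arnoldVec_eq_smul_one {n : ℕ} (D : ArnoldAlgebra n →ₗ[ℚ] ArnoldAlgebra n)
    (hDG : ∀ (i j : Fin n), i < j → D (ArnoldG i j) = 1) (v : ArnoldGenModule n) :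
    ∃ c : ℚ, D (arnoldVec v) = c • (1 : ArnoldAlgebra n) := by
  induction v using Finsupp.induction_linear with
  | zero => exact ⟨0, by simp [arnoldVec]⟩
  | add v w hv hw =>
    obtain ⟨c, hc⟩ := hv
    obtain ⟨d, hd⟩ := hw
    refine ⟨c + d, ?_⟩
    rw [add_smul, ← hc, ← hd, ← map_add]
    simp [arnoldVec]
  | single p r =>
    refine ⟨r, ?_⟩
    rw [← hDG p.1.1 p.1.2 p.2, arnoldG_eq_arnoldVec p.2, ← map_smul]
    congr 1
    rw [arnoldVec, arnoldVec, ← map_smul, ← map_smul, Finsupp.smul_single_one]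

theorem arnoldAlgebra_induction {n : ℕ} {P : ArnoldAlgebra n → Prop}
    (algebraMap : ∀ r : ℚ, P (algebraMap ℚ _ r))
    (add : ∀ x y, P x → P y → P (x + y))
    (vec_mul : ∀ v x, P x → P (arnoldVec v * x)) (x : ArnoldAlgebra n) : P x := by
  obtain ⟨y, rfl⟩ := RingQuot.mkAlgHom_surjective ℚ (ArnoldRel n) x
  induction y using CliffordAlgebra.left_induction with
  | algebraMap r => simpa using algebraMap r
  | add x y hx hy => rw [map_add]; exact add _ _ hx hy
  | ι_mul x m hx => rw [map_mul]; exact vec_mul m _ hx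

/-- For `n ≥ 2`, the Arnold differential algebra `(A(n), ∂)` — where `∂` is the (unique)
degree `-1` graded derivation with `∂G_{ij} = 1` — is an exact chain complex: `∂∘∂ = 0`
and for every `q` the kernel of `∂` on `A^q(n)` equals the image of `∂` from `A^{q+1}(n)`;
in particular all homology groups vanish.  An explicit contracting homotopy is
`h(γ) = G_{12}·γ`, which satisfies `∂h + h∂ = id`. -/
theorem arnold_complex_is_exact (n : ℕ) (hn : 2 ≤ n)
    (D : ArnoldAlgebra n →ₗ[ℚ] ArnoldAlgebra n)
    (hDG : ∀ (i j : Fin n), i < j → D (ArnoldG i j) = 1)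
    (hDdeg : ∀ (q : ℕ), ∀ a ∈ ArnoldGrade n (q + 1), D a ∈ ArnoldGrade n q)
    (hDzero : ∀ a ∈ ArnoldGrade n 0, D a = 0)
    (hDder : ∀ (q : ℕ) (a b : ArnoldAlgebra n), a ∈ ArnoldGrade n q →
      D (a * b) = D a * b + ((-1 : ℚ) ^ q) • (a * D b)) :
    (∀ x : ArnoldAlgebra n, D (D x) = 0) ∧
    (∀ (q : ℕ) (x : ArnoldAlgebra n), x ∈ ArnoldGrade n q → D x = 0 →
      ∃ y ∈ ArnoldGrade n (q + 1), D y = x) ∧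
    (∀ γ : ArnoldAlgebra n,
      D (ArnoldG (⟨0, by omega⟩ : Fin n) ⟨1, by omega⟩ * γ)
        + ArnoldG (⟨0, by omega⟩ : Fin n) ⟨1, by omega⟩ * D γ = γ) := by
  have leibniz (v : ArnoldGenModule n) (x : ArnoldAlgebra n) :
      D (arnoldVec v * x) = D (arnoldVec v) * x - arnoldVec v * D x := by
    rw [hDder 1 _ x (arnoldVec_mem_grade_one v), pow_one, neg_one_smul, sub_eq_add_neg]
  have h01 : (⟨0, by omega⟩ : Fin n) < ⟨1, by omega⟩ := by simp
  have homotopy (γ : ArnoldAlgebra n) :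
      D (ArnoldG (⟨0, by omega⟩ : Fin n) ⟨1, by omega⟩ * γ)
        + ArnoldG (⟨0, by omega⟩ : Fin n) ⟨1, by omega⟩ * D γ = γ := by
    have hD := hDG _ _ h01
    rw [arnoldG_eq_arnoldVec h01] at hD ⊢
    rw [leibniz, hD, one_mul, sub_add_cancel]
  refine ⟨fun x => ?_, fun q x hx hDx => ?_, homotopy⟩
  · induction x using arnoldAlgebra_induction with
    | algebraMap r =>
      rw [Algebra.algebraMap_eq_smul_one, map_smul, hDzero 1 (one_mem_arnoldGrade_zero n),
        smul_zero, map_zero]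
    | add x y hx hy => rw [map_add, map_add, hx, hy, add_zero]
    | vec_mul v x hx =>
      obtain ⟨c, hc⟩ := exists_map_arnoldVec_eq_smul_one D hDG v
      rw [leibniz, map_sub, leibniz, hc, hx, mul_zero, sub_zero, smul_one_mul, smul_one_mul,
        map_smul, sub_self]
  · refine ⟨_, ?_, by simpa only [hDx, mul_zero, add_zero] using homotopy x⟩
    rw [arnoldG_eq_arnoldVec h01]
    exact arnoldVec_mul_mem_grade _ hx
end

section
/- Let n ≥ 4 and let H_q^k denote the bidegree-(k,q) cohomology of the Križ model (E(CP^1,n), d). Then the nonzero bigraded components are exactly H_q^q and H_{q+1}^{q+3}, for q = 0, 1, …, n−3, with H_q^q ≅ H_{q+1}^{q+3}; and the two-variable Poincaré polynomial satisfies Σ_{k,q ≥ 0} (dim H_q^k) t^k s^q = (1 + st³)(1 + 2st)(1 + 3st)⋯(1 + (n−2)st). -/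
universe v

/-- The ordered product of the exterior generators of a canonical monomial. -/
def krizGprod {n : ℕ} {E : Type v} [Ring E] (G : Fin n → Fin n → E)
    (e : Fin n → Option (Fin n)) : E :=
  ((List.finRange n).filterMap fun j => (e j).map fun i => G i j).prod

/-- The Križ model `E(ℂP¹,n)` of the complex projective line (`A = ℚ[w]/(w²)`, `deg w = 2`,
`m = 1`): a bigraded graded-commutative `ℚ`-algebra with classes `w i = p_i^*(w)`, exterior
generators `G_{ij}` of bidegree `(1,1)`, the Križ relations, the differential `d` with
`d(G_{ij}) = p_i^*(w) + p_j^*(w)`, the `S_n`-action, and the canonical basis. -/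
structure KrizCP1 (n : ℕ) (E : Type v) [Ring E] [Algebra ℚ E] where
  /-- the bigrading: `comp q k` has exterior degree `q` and total degree `k` -/
  comp : ℕ → ℕ → Submodule ℚ E
  internal : DirectSum.IsInternal fun qk : ℕ × ℕ => comp qk.1 qk.2
  one_mem : (1 : E) ∈ comp 0 0
  mul_mem : ∀ {q k q' k'} {a b : E}, a ∈ comp q k → b ∈ comp q' k' →
    a * b ∈ comp (q + q') (k + k')
  gcomm : ∀ {q k q' k'} {a b : E}, a ∈ comp q k → b ∈ comp q' k' →
    a * b = ((-1 : ℚ) ^ (k * k')) • (b * a)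
  /-- the classes `w i = p_i^*(w)` -/
  w : Fin n → E
  w_mem : ∀ i, w i ∈ comp 0 2
  w_sq : ∀ i, w i * w i = 0
  /-- the exterior generators -/
  G : Fin n → Fin n → E
  G_symm : ∀ i j, G i j = G j i
  G_mem : ∀ {i j : Fin n}, i ≠ j → G i j ∈ comp 1 1
  /-- the relation `p_j^*(w)G_{ij} = p_i^*(w)G_{ij}` -/
  rel_p : ∀ {i j : Fin n}, i ≠ j → w j * G i j = w i * G i j
  /-- the relation `G_{ik}G_{jk} = G_{ij}G_{jk} - G_{ij}G_{ik}` for `i < j < k` -/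
  rel_G : ∀ {i j k : Fin n}, i < j → j < k →
    G i k * G j k = G i j * G j k - G i j * G i k
  /-- the differential -/
  d : E →ₗ[ℚ] E
  d_mem : ∀ {q k : ℕ} {a : E}, a ∈ comp (q + 1) k → d a ∈ comp q (k + 1)
  d_zero : ∀ {k : ℕ} {a : E}, a ∈ comp 0 k → d a = 0
  d_w : ∀ i, d (w i) = 0
  d_G : ∀ {i j : Fin n}, i ≠ j → d (G i j) = w i + w j
  d_d : ∀ x : E, d (d x) = 0
  leibniz : ∀ {q k : ℕ} {a : E}, a ∈ comp q k → ∀ b : E,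
    d (a * b) = d a * b + ((-1 : ℚ) ^ k) • (a * d b)
  /-- the `S_n`-action -/
  act : Equiv.Perm (Fin n) →* (E ≃ₐ[ℚ] E)
  act_w : ∀ (σ : Equiv.Perm (Fin n)) (i : Fin n), act σ (w i) = w (σ i)
  act_G : ∀ (σ : Equiv.Perm (Fin n)) (i j : Fin n), act σ (G i j) = G (σ i) (σ j)
  act_comp : ∀ (σ : Equiv.Perm (Fin n)) (q k : ℕ) (x : E), x ∈ comp q k → act σ x ∈ comp q k
  /-- the canonical monomials `(∏_{i ∈ T} w i)·G_{I_*J_*}` (with `T ∩ J_* = ∅`) span `E` -/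
  span_canon : Submodule.span ℚ
    {x : E | ∃ (T : Finset (Fin n)) (e : Fin n → Option (Fin n)),
      (∀ j i, e j = some i → i < j) ∧ (∀ j, e j ≠ none → j ∉ T) ∧
      x = (List.ofFn fun i => if i ∈ T then w i else 1).prod * krizGprod G e} = ⊤
  /-- the canonical monomials are linearly independent -/
  indep_canon : LinearIndependent ℚ
    (fun c : {Te : Finset (Fin n) × (Fin n → Option (Fin n)) //
        (∀ j i, Te.2 j = some i → i < j) ∧ (∀ j, Te.2 j ≠ none → j ∉ Te.1)} =>
      (List.ofFn fun i => if i ∈ c.1.1 then w i else 1).prod * krizGprod G c.1.2)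

namespace KrizCP1

variable {n : ℕ} {E : Type v} [Ring E] [Algebra ℚ E]

/-- The cocycles in bidegree `(k, q)`. -/
def cocycles (K : KrizCP1 n E) (q k : ℕ) : Submodule ℚ E :=
  K.comp q k ⊓ LinearMap.ker K.d

/-- The coboundaries in bidegree `(k, q)`. -/
def boundaries (K : KrizCP1 n E) (q k : ℕ) : Submodule ℚ E :=
  Submodule.map K.d (K.comp (q + 1) (k - 1))

/-- The bidegree-`(k, q)` cohomology `H_q^k` of the Križ model of `ℂP¹`; by Križ's theorem
this is the rational cohomology of the configuration space `F(ℂP¹, n)`. -/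
abbrev H (K : KrizCP1 n E) (q k : ℕ) :=
  ↥(K.cocycles q k) ⧸ (Submodule.comap (K.cocycles q k).subtype (K.boundaries q k))

end KrizCP1

namespace KrizCP1

section Translates

variable {E : Type v} [Ring E] [Algebra ℚ E] {κ : Type*}

/-- The sum of the left translates `f k * V`. -/
def translates (f : κ → E) (V : Submodule ℚ E) : Submodule ℚ E :=
  ⨆ k, V.map (LinearMap.mulLeft ℚ (f k))

theorem mul_mem_translates (f : κ → E) {V : Submodule ℚ E} (k : κ) {v : E} (hv : v ∈ V) :
    f k * v ∈ translates f V :=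
  Submodule.mem_iSup_of_mem k ⟨v, hv, rfl⟩

theorem translates_le {f : κ → E} {V S : Submodule ℚ E}
    (h : ∀ k, ∀ v ∈ V, f k * v ∈ S) : translates f V ≤ S := by
  refine iSup_le fun k => ?_
  rintro _ ⟨v, hv, rfl⟩
  exact h k v hv

theorem map_mem_translates {f : κ → E} {V S : Submodule ℚ E} (φ : E →ₗ[ℚ] E)
    (h : ∀ k, ∀ v ∈ V, φ (f k * v) ∈ S) {x : E} (hx : x ∈ translates f V) : φ x ∈ S :=
  translates_le (S := S.comap φ) h hx

variable [Fintype κ]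

/-- The linear map `v ↦ ∑ k, f k * v k`. -/
def combination (f : κ → E) (V : Submodule ℚ E) : (κ → V) →ₗ[ℚ] E :=
  ∑ k, LinearMap.mulLeft ℚ (f k) ∘ₗ V.subtype ∘ₗ LinearMap.proj k

theorem combination_apply (f : κ → E) (V : Submodule ℚ E) (v : κ → V) :
    combination f V v = ∑ k, f k * (v k : E) := by
  simp [combination]

theorem range_combination (f : κ → E) (V : Submodule ℚ E) :
    LinearMap.range (combination f V) = translates f V := by
  classical
  apply le_antisymm
  · rintro _ ⟨v, rfl⟩
    rw [combination_apply]
    exact Submodule.sum_mem _ fun k _ => mul_mem_translates f k (v k).2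
  · refine translates_le fun k v hv => ⟨Pi.single k ⟨v, hv⟩, ?_⟩
    rw [combination_apply, Finset.sum_eq_single k]
    · simp
    · intro j _ hj
      simp [hj]
    · simp

theorem exists_of_mem_translates {f : κ → E} {V : Submodule ℚ E} {x : E}
    (hx : x ∈ translates f V) : ∃ v : κ → V, x = ∑ k, f k * (v k : E) := by
  rw [← range_combination] at hx
  obtain ⟨v, rfl⟩ := hx
  exact ⟨v, combination_apply f V v⟩

instance finite_translates (f : κ → E) (V : Submodule ℚ E) [Module.Finite ℚ V] :
    Module.Finite ℚ (translates f V) := by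
  rw [← range_combination]
  infer_instance

theorem finrank_translates_add_finrank_ker (f : κ → E) (V : Submodule ℚ E)
    [Module.Finite ℚ V] :
    Module.finrank ℚ (translates f V) + Module.finrank ℚ (LinearMap.ker (combination f V)) =
      Fintype.card κ * Module.finrank ℚ V := by
  rw [← range_combination, LinearMap.finrank_range_add_finrank_ker,
    Module.finrank_pi_fintype]
  simp

theorem combination_injective_of_finrank {f : κ → E} {V : Submodule ℚ E} [Module.Finite ℚ V]
    (h : Module.finrank ℚ (translates f V) = Fintype.card κ * Module.finrank ℚ V) :
    Function.Injective (combination f V) := by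
  have := finrank_translates_add_finrank_ker f V
  rw [← LinearMap.ker_eq_bot, ← Submodule.finrank_eq_zero (R := ℚ)]
  omega

end Translates

section CohomologyBasis

variable {E : Type v} [Ring E] [Algebra ℚ E] {ι κ : Type*} [Fintype ι] [Fintype κ]

/-- The family `h` of cocycles of `V` represents a basis of the cohomology of `(V, d)`. -/
structure IsCohomologyBasis (d : E →ₗ[ℚ] E) (V : Submodule ℚ E) (h : ι → E) : Prop where
  mem : ∀ t, h t ∈ V
  d_eq_zero : ∀ t, d (h t) = 0
  span : ∀ x ∈ V, d x = 0 → ∃ c : ι → ℚ, ∃ v ∈ V, x = ∑ t, c t • h t + d v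
  indep : ∀ c : ι → ℚ, ∀ v ∈ V, ∑ t, c t • h t = d v → ∀ t, c t = 0

theorem IsCohomologyBasis.reindex {ι' : Type*} [Fintype ι'] {d : E →ₗ[ℚ] E}
    {V : Submodule ℚ E} {h : ι → E} (H : IsCohomologyBasis d V h) (e : ι' ≃ ι) :
    IsCohomologyBasis d V (h ∘ e) where
  mem t := H.mem _
  d_eq_zero t := H.d_eq_zero _
  span x hx hdx := by
    obtain ⟨c, v, hv, rfl⟩ := H.span x hx hdx
    refine ⟨c ∘ e, v, hv, ?_⟩
    rw [← e.sum_comp]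
    rfl
  indep c v hv hc t := by
    have := H.indep (c ∘ e.symm) v hv
    rw [← e.sum_comp] at this
    simpa using this (by simpa using hc) (e t)

/-- The factors contributed by a new point in a basis adapted to the differential. -/
def adaptedFactor (u g : E) (z : κ → E) : Option (Option (Option κ)) → E
  | none => 1
  | some none => u
  | some (some none) => g
  | some (some (some i)) => z i

theorem exists_of_mem_translates_adaptedFactor {u g : E} {z : κ → E} {V : Submodule ℚ E} {x : E}
    (hx : x ∈ translates (adaptedFactor u g z) V) :
    ∃ a ∈ V, ∃ b ∈ V, ∃ c ∈ V, ∃ e : κ → E, (∀ i, e i ∈ V) ∧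
      x = a + (u * b + (g * c + ∑ i, z i * e i)) := by
  obtain ⟨v, rfl⟩ := exists_of_mem_translates hx
  exact ⟨v none, (v _).2, v (some none), (v _).2, v (some (some none)), (v _).2,
    fun i => v (some (some (some i))), fun i => (v _).2,
    by simp [Fintype.sum_option, adaptedFactor]⟩

theorem eq_of_adaptedFactor {u g : E} {z : κ → E} {V : Submodule ℚ E}
    (hinj : Function.Injective (combination (adaptedFactor u g z) V))
    {a b c a' b' c' : E} {e e' : κ → E} (ha : a ∈ V) (hb : b ∈ V) (hc : c ∈ V)
    (he : ∀ i, e i ∈ V) (ha' : a' ∈ V) (hb' : b' ∈ V) (hc' : c' ∈ V) (he' : ∀ i, e' i ∈ V)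
    (h : a + (u * b + (g * c + ∑ i, z i * e i)) =
      a' + (u * b' + (g * c' + ∑ i, z i * e' i))) :
    a = a' ∧ b = b' ∧ c = c' ∧ ∀ i, e i = e' i := by
  let pack : ∀ a b c : V, (κ → V) → Option (Option (Option κ)) → V := fun a b c e o =>
    o.elim a fun o => o.elim b fun o => o.elim c e
  have key := @hinj (pack ⟨a, ha⟩ ⟨b, hb⟩ ⟨c, hc⟩ fun i => ⟨e i, he i⟩)
    (pack ⟨a', ha'⟩ ⟨b', hb'⟩ ⟨c', hc'⟩ fun i => ⟨e' i, he' i⟩) (by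
      simpa [combination_apply, Fintype.sum_option, adaptedFactor, pack] using h)
  refine ⟨congrArg Subtype.val (congrFun key none),
    congrArg Subtype.val (congrFun key (some none)),
    congrArg Subtype.val (congrFun key (some (some none))), fun i =>
    congrArg Subtype.val (congrFun key (some (some (some i))))⟩

/-- The cohomology classes obtained from `h` by multiplying with `1` or one of the `z i`. -/
def extendClasses (z : κ → E) (h : ι → E) (t : Option κ × ι) : E :=
  t.1.elim 1 z * h t.2

theorem sum_extendClasses (z : κ → E) (h : ι → E) (c : Option κ × ι → ℚ) :
    ∑ t, c t • extendClasses z h t =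
      ∑ s, c (none, s) • h s + ∑ i, z i * ∑ s, c (some i, s) • h s := by
  simp [Fintype.sum_prod_type, Fintype.sum_option, extendClasses, Finset.mul_sum]

/-- Adjoining an acyclic pair `g ↦ u` and odd cocycles `z i`. -/
theorem IsCohomologyBasis.extend {d : E →ₗ[ℚ] E} {V : Submodule ℚ E} {h : ι → E}
    (H : IsCohomologyBasis d V h) {u g : E} {z : κ → E}
    (hinj : Function.Injective (combination (adaptedFactor u g z) V))
    (hV : ∀ v ∈ V, d v ∈ V) (hu : ∀ x, d (u * x) = u * d x)
    (hg : ∀ x, d (g * x) = u * x - g * d x) (hz : ∀ i x, d (z i * x) = -(z i * d x)) :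
    IsCohomologyBasis d (translates (adaptedFactor u g z) V) (extendClasses z h) := by
  have mem1 : ∀ v ∈ V, v ∈ translates (adaptedFactor u g z) V := fun v hv => by
    simpa [adaptedFactor] using mul_mem_translates (adaptedFactor u g z) none hv
  have memg : ∀ v ∈ V, g * v ∈ translates (adaptedFactor u g z) V := fun v hv =>
    mul_mem_translates (adaptedFactor u g z) (some (some none)) hv
  have memz : ∀ i, ∀ v ∈ V, z i * v ∈ translates (adaptedFactor u g z) V := fun i v hv =>
    mul_mem_translates (adaptedFactor u g z) (some (some (some i))) hv
  have hd : ∀ a b c : E, ∀ e : κ → E, d (a + (u * b + (g * c + ∑ i, z i * e i))) =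
      d a + (u * (d b + c) + (g * (-d c) + ∑ i, z i * (-d (e i)))) := by
    intro a b c e
    simp only [map_add, map_sum, hu, hg, hz, mul_add, mul_neg]
    abel
  constructor
  · rintro ⟨_ | i, s⟩
    · simpa [extendClasses] using mem1 _ (H.mem s)
    · exact memz i _ (H.mem s)
  · rintro ⟨_ | i, s⟩
    · simp [extendClasses, H.d_eq_zero]
    · simp [extendClasses, hz, H.d_eq_zero]
  · intro x hx hdx
    obtain ⟨a, ha, b, hb, c, hc, e, he, rfl⟩ := exists_of_mem_translates_adaptedFactor hx
    rw [hd] at hdx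
    obtain ⟨h1, h2, h3, h4⟩ := eq_of_adaptedFactor (a' := 0) (b' := 0) (c' := 0)
      (e' := fun _ => 0) hinj (hV a ha) (V.add_mem (hV b hb) hc) (V.neg_mem (hV c hc))
      (fun i => V.neg_mem (hV _ (he i))) V.zero_mem V.zero_mem V.zero_mem
      (fun _ => V.zero_mem) (by simpa using hdx)
    obtain ⟨α, v, hv, hα⟩ := H.span a ha h1
    choose β y hy hβ using fun i => H.span (e i) (he i) (by simpa using h4 i)
    refine ⟨fun t => t.1.elim (α t.2) fun i => β i t.2, v + (g * b + ∑ i, z i * (-y i)),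
      Submodule.add_mem _ (mem1 v hv) (Submodule.add_mem _ (memg b hb)
        (Submodule.sum_mem _ fun i _ => memz i _ (V.neg_mem (hy i)))), ?_⟩
    have hc' : c = -d b := (neg_eq_of_add_eq_zero_right h2).symm
    rw [sum_extendClasses]
    simp only [Option.elim, map_add, map_sum, hg, hz, map_neg, mul_neg, neg_neg, hc']
    have : ∑ i, z i * e i = ∑ i, z i * ∑ s, β i s • h s + ∑ i, z i * d (y i) := by
      rw [← Finset.sum_add_distrib]
      exact Finset.sum_congr rfl fun i _ => by rw [← mul_add, ← hβ]
    rw [this, hα]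
    abel
  · intro c v hv hcv
    obtain ⟨a, ha, b, hb, c', hc', e, he, rfl⟩ := exists_of_mem_translates_adaptedFactor hv
    rw [hd, sum_extendClasses] at hcv
    obtain ⟨h1, -, -, h4⟩ := eq_of_adaptedFactor (b := 0) (c := 0) hinj
      (V.sum_mem fun s _ => V.smul_mem (c (none, s)) (H.mem s)) V.zero_mem V.zero_mem
      (fun i => V.sum_mem fun s _ => V.smul_mem (c (some i, s)) (H.mem s)) (hV a ha)
      (V.add_mem (hV b hb) hc') (V.neg_mem (hV _ hc')) (fun i => V.neg_mem (hV _ (he i)))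
      (by simpa using hcv)
    rintro ⟨_ | i, s⟩
    · exact H.indep (fun s => c (none, s)) a ha h1 s
    · exact H.indep (fun s => c (some i, s)) (-e i) (V.neg_mem (he i))
        (by rw [map_neg]; exact h4 i) s

/-- Adjoining an acyclic pair `g ↦ u` and an odd element `z` with `z ↦ -2 y`, where the
cohomology has basis `1, y`. -/
theorem IsCohomologyBasis.extend_twisted {d : E →ₗ[ℚ] E} {V : Submodule ℚ E} {y : E}
    (H : IsCohomologyBasis d V (fun b : Bool => bif b then y else 1)) {u g z : E}
    (hinj : Function.Injective (combination (adaptedFactor u g fun _ : Fin 1 => z) V))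
    (hV : ∀ v ∈ V, d v ∈ V) (hu : ∀ x, d (u * x) = u * d x)
    (hg : ∀ x, d (g * x) = u * x - g * d x)
    (hz : ∀ x, d (z * x) = (-2 : ℚ) • (y * x) - z * d x)
    (hy : ∀ x, d (y * x) = y * d x) (hyV : ∀ v ∈ V, y * v ∈ V) (hyy : y * y = 0) :
    IsCohomologyBasis d (translates (adaptedFactor u g fun _ : Fin 1 => z) V)
      (fun b : Bool => bif b then z * y else 1) := by
  set V' := translates (adaptedFactor u g fun _ : Fin 1 => z) V with hV'
  have mem1 : ∀ v ∈ V, v ∈ V' := fun v hv => by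
    simpa [adaptedFactor] using mul_mem_translates (adaptedFactor u g fun _ : Fin 1 => z) none hv
  have memg : ∀ v ∈ V, g * v ∈ V' := fun v hv =>
    mul_mem_translates (adaptedFactor u g fun _ : Fin 1 => z) (some (some none)) hv
  have memz : ∀ v ∈ V, z * v ∈ V' := fun v hv =>
    mul_mem_translates (adaptedFactor u g fun _ : Fin 1 => z) (some (some (some 0))) hv
  have one_mem : (1 : E) ∈ V := H.mem false
  have y_mem : y ∈ V := H.mem true
  have d_one : d 1 = 0 := H.d_eq_zero false
  have d_y : d y = 0 := H.d_eq_zero true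
  have hd : ∀ a b c e : E, d (a + (u * b + (g * c + ∑ _i : Fin 1, z * e))) =
      (d a + (-2 : ℚ) • (y * e)) + (u * (d b + c) + (g * (-d c) + ∑ _i : Fin 1, z * (-d e))) := by
    intro a b c e
    simp only [map_add, hu, hg, hz, mul_add, mul_neg, Finset.univ_unique,
      Finset.sum_singleton]
    abel
  have z_mem : z ∈ V' := by simpa using memz 1 one_mem
  have d_z : d z = (-2 : ℚ) • y := by simpa [d_one] using hz 1
  have decomp : ∀ v ∈ V, d v = 0 → ∃ α β : ℚ, ∃ x ∈ V, v = α • 1 + β • y + d x := by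
    intro v hv hdv
    obtain ⟨c, x, hx, rfl⟩ := H.span v hv hdv
    exact ⟨c false, c true, x, hx, by simp [add_comm]⟩
  have indep : ∀ α β : ℚ, ∀ x ∈ V, α • 1 + β • y = d x → α = 0 ∧ β = 0 := by
    intro α β x hx hxe
    have := H.indep (fun b => bif b then β else α) x hx (by simpa [add_comm] using hxe)
    exact ⟨this false, this true⟩
  constructor
  · rintro (_ | _)
    · exact mem1 1 one_mem
    · exact memz y y_mem
  · rintro (_ | _)
    · exact d_one
    · simp [hz, hyy, d_y]
  · intro x hx hdx
    obtain ⟨a, ha, b, hb, c, hc, e, he, rfl⟩ := exists_of_mem_translates_adaptedFactor hx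
    obtain ⟨e, rfl⟩ : ∃ e' : E, e = fun _ => e' := ⟨e 0, by ext i; rw [Subsingleton.elim i 0]⟩
    have he := he 0
    rw [hd] at hdx
    obtain ⟨h1, h2, h3, h4⟩ := eq_of_adaptedFactor (a' := 0) (b' := 0) (c' := 0)
      (e := fun _ => -d e) (e' := fun _ => 0) hinj
      (V.add_mem (hV a ha) (V.smul_mem (-2 : ℚ) (hyV e he))) (V.add_mem (hV b hb) hc)
      (V.neg_mem (hV c hc)) (fun i => V.neg_mem (hV _ he)) V.zero_mem V.zero_mem V.zero_mem
      (fun _ => V.zero_mem) (by simpa using hdx)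
    obtain ⟨α, β, p, hp, rfl⟩ := decomp e he (by simpa using h4 0)
    have e1 : (0 : ℚ) • (1 : E) + (2 * α) • y = d (a + (-2 : ℚ) • (y * p)) := by
      rw [map_add, map_smul, hy]
      have : d a = (2 : ℚ) • (y * (α • 1 + β • y + d p)) := by
        rw [eq_neg_of_add_eq_zero_left h1, ← neg_smul, neg_neg]
      rw [this]
      simp only [mul_add, mul_smul_comm, hyy, mul_one, smul_add, smul_smul]
      module
    have α0 : α = 0 := by
      have := (indep 0 (2 * α) _ (V.add_mem ha (V.smul_mem _ (hyV p hp))) e1).2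
      linarith
    obtain ⟨γ, δ, r, hr, hγ⟩ := decomp _ (V.add_mem ha (V.smul_mem (-2) (hyV p hp)))
      (by rw [← e1, α0]; simp)
    refine ⟨fun b => bif b then β else γ, g * b + (r + (-z * p + (-δ / 2) • z)),
      ?_, ?_⟩
    · refine V'.add_mem (memg b hb) (V'.add_mem (mem1 r hr) (V'.add_mem ?_
        (V'.smul_mem _ z_mem)))
      rw [neg_mul]
      exact V'.neg_mem (memz p hp)
    · have hc' : c = -d b := (neg_eq_of_add_eq_zero_right h2).symm
      have ha' : a = γ • 1 + δ • y + d r + (2 : ℚ) • (y * p) := by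
        rw [← hγ]; module
      rw [ha', hc', α0]
      simp only [Finset.univ_unique, Finset.sum_singleton, map_add, map_smul, neg_mul, map_neg,
        hg, hz, d_z, Fintype.sum_bool, cond_true, cond_false, mul_add, mul_smul_comm, mul_one,
        mul_neg]
      module
  · intro c v hv hcv
    obtain ⟨a, ha, b, hb, c', hc', e, he, rfl⟩ := exists_of_mem_translates_adaptedFactor hv
    obtain ⟨e, rfl⟩ : ∃ e' : E, e = fun _ => e' := ⟨e 0, by ext i; rw [Subsingleton.elim i 0]⟩
    have he := he 0
    rw [hd] at hcv
    obtain ⟨h1, -, -, h4⟩ := eq_of_adaptedFactor (a := c false • 1) (b := 0) (c := 0)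
      (e := fun _ => c true • y) (e' := fun _ => -d e) hinj
      (V.smul_mem _ one_mem) V.zero_mem V.zero_mem (fun _ => V.smul_mem _ y_mem)
      (V.add_mem (hV a ha) (V.smul_mem (-2 : ℚ) (hyV e he)))
      (V.add_mem (hV b hb) hc') (V.neg_mem (hV _ hc')) (fun i => V.neg_mem (hV _ he))
      (by simpa [add_comm] using hcv)
    have ht : c true = 0 :=
      (indep 0 (c true) (-e) (V.neg_mem he) (by simpa using h4 0)).2
    obtain ⟨α, β, p, hp, rfl⟩ := decomp e he (by simpa [ht] using h4 0)
    have hf : c false = 0 := by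
      refine (indep (c false) (2 * α) (a + (-2 : ℚ) • (y * p))
        (V.add_mem ha (V.smul_mem _ (hyV p hp))) ?_).1
      rw [h1, map_add, map_smul, hy]
      simp only [mul_add, mul_smul_comm, hyy, mul_one, smul_add, smul_smul]
      module
    rintro (_ | _)
    · exact hf
    · exact ht

end CohomologyBasis

section Stages

variable {n : ℕ} {E : Type v} [Ring E] [Algebra ℚ E] (K : KrizCP1 n E)

/-- The classes `w i`, extended by zero to all natural indices. -/
def wNat (i : ℕ) : E := if h : i < n then K.w ⟨i, h⟩ else 0

/-- The generators `G i j`, extended by zero to all natural indices. -/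
def gNat (i j : ℕ) : E := if h : i < n ∧ j < n then K.G ⟨i, h.1⟩ ⟨j, h.2⟩ else 0

theorem wNat_mem (i : ℕ) : K.wNat i ∈ K.comp 0 2 := by
  unfold wNat
  split_ifs with h
  · exact K.w_mem _
  · exact zero_mem _

theorem gNat_mem {i j : ℕ} (hij : i ≠ j) : K.gNat i j ∈ K.comp 1 1 := by
  unfold gNat
  split_ifs with h
  · exact K.G_mem (by simpa using hij)
  · exact zero_mem _

theorem wNat_mul_self (i : ℕ) : K.wNat i * K.wNat i = 0 := by
  unfold wNat
  split_ifs with h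
  · exact K.w_sq _
  · simp

theorem wNat_mul_wNat (i j : ℕ) : K.wNat i * K.wNat j = K.wNat j * K.wNat i := by
  simpa [show (-1 : ℚ) ^ 4 = 1 by norm_num] using K.gcomm (K.wNat_mem i) (K.wNat_mem j)

theorem gNat_mul_wNat {i j : ℕ} (hij : i ≠ j) (k : ℕ) :
    K.gNat i j * K.wNat k = K.wNat k * K.gNat i j := by
  simpa using K.gcomm (K.gNat_mem hij) (K.wNat_mem k)

theorem gNat_mul_gNat {i j k l : ℕ} (hij : i ≠ j) (hkl : k ≠ l) :
    K.gNat i j * K.gNat k l = -(K.gNat k l * K.gNat i j) := by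
  simpa using K.gcomm (K.gNat_mem hij) (K.gNat_mem hkl)

theorem gNat_mul_self {i j : ℕ} (hij : i ≠ j) : K.gNat i j * K.gNat i j = 0 := by
  have h := K.gNat_mul_gNat hij hij
  have h2 : (2 : ℚ) • (K.gNat i j * K.gNat i j) = 0 := by
    rw [two_smul]
    nth_rw 1 [h]
    exact neg_add_cancel _
  exact (smul_eq_zero.mp h2).resolve_left two_ne_zero

theorem wNat_mul_gNat {i j : ℕ} (hij : i ≠ j) :
    K.wNat j * K.gNat i j = K.wNat i * K.gNat i j := by
  unfold gNat
  split_ifs with h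
  · simp only [wNat, h.1, h.2, dif_pos]
    exact K.rel_p (by simpa using hij)
  · simp

theorem gNat_arnold {i j k : ℕ} (hij : i < j) (hjk : j < k) :
    K.gNat i k * K.gNat j k = K.gNat i j * K.gNat j k - K.gNat i j * K.gNat i k := by
  by_cases hk : k < n
  · have hj : j < n := hjk.trans hk
    have hi : i < n := hij.trans hj
    simp only [gNat, hi, hj, hk, and_self, dif_pos]
    exact K.rel_G (by simpa using hij) (by simpa using hjk)
  · simp [gNat, hk]

theorem d_one : K.d 1 = 0 := K.d_zero K.one_mem

theorem d_wNat_mul (i : ℕ) (x : E) : K.d (K.wNat i * x) = K.wNat i * K.d x := by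
  rw [K.leibniz (K.wNat_mem i), K.d_zero (K.wNat_mem i)]
  simp

theorem d_mul_of_mem_comp_one {a : E} (ha : a ∈ K.comp 1 1) (x : E) :
    K.d (a * x) = K.d a * x - a * K.d x := by
  rw [K.leibniz ha]
  simp [sub_eq_add_neg]

theorem d_gNat {i j : ℕ} (hij : i ≠ j) (hi : i < n) (hj : j < n) :
    K.d (K.gNat i j) = K.wNat i + K.wNat j := by
  simp only [gNat, wNat, hi, hj, and_self, dif_pos]
  exact K.d_G (by simpa using hij)

/-- The canonical factors contributed by the point `m`. -/
def stageFactor (m : ℕ) : Option (Option (Fin m)) → E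
  | none => 1
  | some none => K.wNat m
  | some (some i) => K.gNat i m

/-- The subalgebra generated by the classes of the first `m` points. -/
def stage : ℕ → Submodule ℚ E
  | 0 => Submodule.span ℚ {1}
  | m + 1 => translates (K.stageFactor m) (stage m)

variable {K}

theorem stage_le_succ (m : ℕ) : K.stage m ≤ K.stage (m + 1) := fun v hv => by
  have h : (1 : E) * v ∈ K.stage (m + 1) := mul_mem_translates (K.stageFactor m) none hv
  simpa using h

theorem wNat_mul_mem_succ {m : ℕ} {v : E} (hv : v ∈ K.stage m) :
    K.wNat m * v ∈ K.stage (m + 1) :=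
  mul_mem_translates (K.stageFactor m) (some none) hv

theorem gNat_mul_mem_succ {i m : ℕ} (hi : i < m) {v : E} (hv : v ∈ K.stage m) :
    K.gNat i m * v ∈ K.stage (m + 1) :=
  mul_mem_translates (K.stageFactor m) (some (some ⟨i, hi⟩)) hv

theorem one_mem_stage (m : ℕ) : (1 : E) ∈ K.stage m := by
  induction m with
  | zero => exact Submodule.mem_span_singleton_self 1
  | succ m ih => exact stage_le_succ m ih

theorem map_stage_succ {m : ℕ} {S : Submodule ℚ E} (φ : E →ₗ[ℚ] E)
    (h1 : ∀ v ∈ K.stage m, φ v ∈ S) (hw : ∀ v ∈ K.stage m, φ (K.wNat m * v) ∈ S)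
    (hg : ∀ k < m, ∀ v ∈ K.stage m, φ (K.gNat k m * v) ∈ S) :
    ∀ x ∈ K.stage (m + 1), φ x ∈ S := by
  intro x hx
  refine map_mem_translates φ ?_ hx
  rintro (_ | _ | k) v hv
  · simpa [stageFactor] using h1 v hv
  · exact hw v hv
  · exact hg k k.2 v hv

theorem wNat_mul_mem {m i : ℕ} (hi : i < m) : ∀ v ∈ K.stage m, K.wNat i * v ∈ K.stage m := by
  induction m generalizing i with
  | zero => omega
  | succ m ih =>
    refine map_stage_succ (LinearMap.mulLeft ℚ (K.wNat i)) ?_ ?_ ?_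
    · intro v hv
      rcases Nat.lt_succ_iff_lt_or_eq.mp hi with h | rfl
      · exact stage_le_succ m (ih h v hv)
      · exact wNat_mul_mem_succ hv
    · intro v hv
      rw [LinearMap.mulLeft_apply, ← mul_assoc]
      rcases Nat.lt_succ_iff_lt_or_eq.mp hi with h | rfl
      · rw [K.wNat_mul_wNat, mul_assoc]
        exact wNat_mul_mem_succ (ih h v hv)
      · rw [K.wNat_mul_self, zero_mul]
        exact zero_mem _
    · intro k hk v hv
      rw [LinearMap.mulLeft_apply, ← mul_assoc]
      rcases Nat.lt_succ_iff_lt_or_eq.mp hi with h | rfl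
      · rw [← K.gNat_mul_wNat hk.ne, mul_assoc]
        exact gNat_mul_mem_succ hk (ih h v hv)
      · rw [K.wNat_mul_gNat hk.ne, ← K.gNat_mul_wNat hk.ne, mul_assoc]
        exact gNat_mul_mem_succ hk (ih hk v hv)

theorem gNat_mul_mem {m i j : ℕ} (hij : i < j) (hj : j < m) :
    ∀ v ∈ K.stage m, K.gNat i j * v ∈ K.stage m := by
  induction m generalizing i j with
  | zero => omega
  | succ m ih =>
    refine map_stage_succ (LinearMap.mulLeft ℚ (K.gNat i j)) ?_ ?_ ?_
    · intro v hv
      rcases Nat.lt_succ_iff_lt_or_eq.mp hj with h | rfl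
      · exact stage_le_succ m (ih hij h v hv)
      · exact gNat_mul_mem_succ hij hv
    · intro v hv
      rw [LinearMap.mulLeft_apply, ← mul_assoc, K.gNat_mul_wNat hij.ne]
      rcases Nat.lt_succ_iff_lt_or_eq.mp hj with h | rfl
      · rw [mul_assoc]
        exact wNat_mul_mem_succ (ih hij h v hv)
      · rw [K.wNat_mul_gNat hij.ne, ← K.gNat_mul_wNat hij.ne, mul_assoc]
        exact gNat_mul_mem_succ hij (wNat_mul_mem hij v hv)
    · intro k hk v hv
      rw [LinearMap.mulLeft_apply, ← mul_assoc]
      rcases Nat.lt_succ_iff_lt_or_eq.mp hj with h | rfl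
      · rw [K.gNat_mul_gNat hij.ne hk.ne, neg_mul, mul_assoc]
        exact neg_mem (gNat_mul_mem_succ hk (ih hij h v hv))
      · have arnold : ∀ a b : ℕ, a < b → b < j →
            K.gNat a j * K.gNat b j * v ∈ K.stage (j + 1) := by
          intro a b hab hb
          rw [K.gNat_arnold hab hb, K.gNat_mul_gNat hab.ne hb.ne,
            K.gNat_mul_gNat hab.ne (hab.trans hb).ne, sub_mul, neg_mul, neg_mul, mul_assoc,
            mul_assoc]
          exact sub_mem (neg_mem (gNat_mul_mem_succ hb (ih hab hb v hv)))
            (neg_mem (gNat_mul_mem_succ (hab.trans hb) (ih hab hb v hv)))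
        rcases lt_trichotomy i k with h | rfl | h
        · exact arnold i k h hk
        · rw [K.gNat_mul_self hij.ne, zero_mul]
          exact zero_mem _
        · rw [K.gNat_mul_gNat hij.ne hk.ne, neg_mul]
          exact neg_mem (arnold k i h hij)

theorem d_mem_stage {m : ℕ} (hm : m ≤ n) : ∀ v ∈ K.stage m, K.d v ∈ K.stage m := by
  induction m with
  | zero =>
    intro v hv
    obtain ⟨c, rfl⟩ := Submodule.mem_span_singleton.mp hv
    rw [map_smul, K.d_one, smul_zero]
    exact zero_mem _
  | succ m ih =>
    have ih := ih (by omega)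
    refine map_stage_succ K.d ?_ ?_ ?_
    · exact fun v hv => stage_le_succ m (ih v hv)
    · intro v hv
      rw [K.d_wNat_mul]
      exact wNat_mul_mem_succ (ih v hv)
    · intro k hk v hv
      rw [K.d_mul_of_mem_comp_one (K.gNat_mem hk.ne), K.d_gNat hk.ne (by omega) (by omega),
        add_mul]
      exact sub_mem (add_mem (stage_le_succ m (wNat_mul_mem hk v hv)) (wNat_mul_mem_succ hv))
        (gNat_mul_mem_succ hk (ih v hv))

theorem list_prod_mul_mem {V : Submodule ℚ E} (l : List E)
    (h : ∀ x ∈ l, ∀ v ∈ V, x * v ∈ V) : ∀ v ∈ V, l.prod * v ∈ V := by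
  induction l with
  | nil => simp
  | cons a l ih =>
    intro v hv
    rw [List.prod_cons, mul_assoc]
    exact h a (by simp) _ (ih (fun x hx => h x (by simp [hx])) v hv)

theorem stage_eq_top : K.stage n = ⊤ := by
  rw [eq_top_iff, ← K.span_canon, Submodule.span_le]
  rintro _ ⟨T, e, he, -, rfl⟩
  refine list_prod_mul_mem _ ?_ _ ?_
  · intro x hx v hv
    obtain ⟨i, rfl⟩ := List.mem_ofFn.mp hx
    split_ifs
    · simpa [wNat] using wNat_mul_mem i.2 v hv
    · simpa using hv
  · rw [← mul_one (krizGprod K.G e)]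
    refine list_prod_mul_mem _ ?_ _ (one_mem_stage n)
    intro x hx v hv
    obtain ⟨j, -, hj⟩ := List.mem_filterMap.mp hx
    obtain ⟨i, hi, rfl⟩ := Option.map_eq_some_iff.mp hj
    simpa [gNat] using gNat_mul_mem (he j i hi) j.2 v hv

variable (K)

instance finite_stage (m : ℕ) : Module.Finite ℚ (K.stage m) := by
  induction m with
  | zero => exact inferInstanceAs (Module.Finite ℚ (Submodule.span ℚ {(1 : E)}))
  | succ m ih => exact finite_translates _ _

theorem finrank_stage_succ_le (m : ℕ) :
    Module.finrank ℚ (K.stage (m + 1)) ≤ (m + 2) * Module.finrank ℚ (K.stage m) := by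
  have := finrank_translates_add_finrank_ker (K.stageFactor m) (K.stage m)
  simp only [Fintype.card_option, Fintype.card_fin] at this
  exact Nat.le_of_add_right_le this.le

theorem finrank_stage_le (m : ℕ) : Module.finrank ℚ (K.stage m) ≤ (m + 1).factorial := by
  induction m with
  | zero => exact (finrank_span_le_card (R := ℚ) ({1} : Set E)).trans (by simp)
  | succ m ih =>
    rw [Nat.factorial_succ]
    exact (K.finrank_stage_succ_le m).trans (Nat.mul_le_mul_left _ ih)

theorem factorial_le_finrank : (n + 1).factorial ≤ Module.finrank ℚ (K.stage n) := by
  classical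
  have : Module.Finite ℚ E := Module.Finite.of_surjective (K.stage n).subtype
    (LinearMap.range_eq_top.mp (by rw [Submodule.range_subtype, stage_eq_top]))
  rw [stage_eq_top, finrank_top]
  refine le_trans ?_ K.indep_canon.fintype_card_le_finrank
  let code (f : ∀ j : Fin n, Option (Option (Fin j))) :
      {Te : Finset (Fin n) × (Fin n → Option (Fin n)) //
        (∀ j i, Te.2 j = some i → i < j) ∧ (∀ j, Te.2 j ≠ none → j ∉ Te.1)} :=
    ⟨(Finset.univ.filter fun j => f j = some none,
      fun j => ((f j).bind id).map (Fin.castLE j.2.le)), by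
      constructor
      · intro j i hi
        obtain ⟨k, -, rfl⟩ := Option.map_eq_some_iff.mp hi
        exact k.2
      · intro j hj hT
        simp only [Finset.mem_filter, Finset.mem_univ, true_and] at hT
        simp [hT] at hj⟩
  have hcode : Function.Injective code := by
    intro f g hfg
    have h1 := congrArg (fun c => c.1.1) hfg
    have h2 := congrArg (fun c => c.1.2) hfg
    funext j
    have h1 := Finset.ext_iff.mp h1 j
    have h2 := congrFun h2 j
    simp only [code, Finset.mem_filter, Finset.mem_univ, true_and] at h1 h2
    have h3 := Option.map_injective (Fin.castLE_injective _) h2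
    rcases hf : f j with _ | _ | a <;> rcases hg : g j with _ | _ | b <;> simp_all
  refine le_trans (le_of_eq ?_) (Fintype.card_le_of_injective code hcode)
  rw [Fintype.card_pi]
  simp only [Fintype.card_option, Fintype.card_fin]
  rw [Fin.prod_univ_eq_prod_range (fun j => j + 1 + 1) n, ← Finset.prod_range_add_one_eq_factorial,
    Finset.prod_range_succ']
  simp

theorem finrank_stage {m : ℕ} (hm : m ≤ n) :
    Module.finrank ℚ (K.stage m) = (m + 1).factorial := by
  refine le_antisymm (K.finrank_stage_le m) ?_
  induction hm using Nat.decreasingInduction with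
  | self => exact K.factorial_le_finrank
  | of_succ m hm ih =>
    rw [Nat.factorial_succ] at ih
    exact Nat.le_of_mul_le_mul_left (ih.trans (K.finrank_stage_succ_le m)) (by omega)

theorem combination_injective {m : ℕ} (hm : m < n) {κ : Type*} [Fintype κ] {f : κ → E}
    (hκ : Fintype.card κ = m + 2) (hf : translates f (K.stage m) = K.stage (m + 1)) :
    Function.Injective (combination f (K.stage m)) := by
  apply combination_injective_of_finrank
  rw [hf, K.finrank_stage hm, K.finrank_stage hm.le, hκ, Nat.factorial_succ]

/-- The last point of stage `m + 2` compared with the first: the generator `G_{i+1,m+1}`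
corrected by `G_{0,m+1}` and by an element `τ i` of the previous stage. -/
def correctedG (m : ℕ) (τ : Fin m → E) (i : Fin m) : E :=
  K.gNat (i + 1) (m + 1) - K.gNat 0 (m + 1) - τ i

theorem translates_adaptedFactor (m : ℕ) {τ : Fin m → E}
    (hτ : ∀ i, ∀ v ∈ K.stage (m + 1), τ i * v ∈ K.stage (m + 1)) :
    translates (adaptedFactor (K.wNat (m + 1) + K.wNat 0) (K.gNat 0 (m + 1)) (K.correctedG m τ))
      (K.stage (m + 1)) = K.stage (m + 2) := by
  set f := adaptedFactor (K.wNat (m + 1) + K.wNat 0) (K.gNat 0 (m + 1)) (K.correctedG m τ) with hf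
  have mem1 : ∀ v ∈ K.stage (m + 1), v ∈ translates f (K.stage (m + 1)) := fun v hv => by
    simpa [hf, adaptedFactor] using mul_mem_translates f none hv
  have memg : ∀ v ∈ K.stage (m + 1), K.gNat 0 (m + 1) * v ∈ translates f (K.stage (m + 1)) :=
    fun v hv => mul_mem_translates f (some (some none)) hv
  apply le_antisymm
  · apply translates_le
    rintro (_ | _ | _ | i) v hv
    · simpa [hf, adaptedFactor] using stage_le_succ _ hv
    · simp only [hf, adaptedFactor, add_mul]
      exact add_mem (wNat_mul_mem_succ hv)
        (stage_le_succ _ (wNat_mul_mem (Nat.succ_pos m) v hv))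
    · exact gNat_mul_mem_succ (Nat.succ_pos m) hv
    · simp only [hf, adaptedFactor, correctedG, sub_mul]
      exact sub_mem (sub_mem (gNat_mul_mem_succ (by omega) hv)
        (gNat_mul_mem_succ (Nat.succ_pos m) hv)) (stage_le_succ _ (hτ i v hv))
  · apply translates_le
    rintro (_ | _ | i) v hv
    · simpa [stageFactor] using mem1 v hv
    · have h := sub_mem (mul_mem_translates f (some none) hv)
        (mem1 _ (wNat_mul_mem (Nat.succ_pos m) v hv))
      simpa [hf, adaptedFactor, stageFactor, add_mul] using h
    · refine Fin.cases ?_ (fun i => ?_) i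
      · exact memg v hv
      · have h := add_mem (add_mem (mul_mem_translates f (some (some (some i))) hv)
          (mem1 _ (hτ i v hv))) (memg v hv)
        simpa [hf, adaptedFactor, stageFactor, correctedG, sub_mul] using h

end Stages

section Cohomology

variable {n : ℕ} {E : Type v} [Ring E] [Algebra ℚ E] (K : KrizCP1 n E)

theorem isCohomologyBasis_stage_one (hn : 0 < n) :
    IsCohomologyBasis K.d (K.stage 1) (fun b : Bool => bif b then K.wNat 0 else 1) := by
  have hmem : ∀ b : Bool, (bif b then K.wNat 0 else 1) ∈ K.stage 1 := by
    rintro (_ | _)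
    · exact one_mem_stage 1
    · simpa using wNat_mul_mem_succ (one_mem_stage (K := K) 0)
  have hd : ∀ b : Bool, K.d (bif b then K.wNat 0 else 1) = 0 := by
    rintro (_ | _)
    · exact K.d_one
    · exact K.d_zero (K.wNat_mem 0)
  have hsum : ∀ f : Option (Option (Fin 0)) → E, ∑ k, f k = f none + f (some none) := by
    intro f
    rw [Fintype.sum_option, Fintype.sum_option, Finset.univ_eq_empty, Finset.sum_empty, add_zero]
  have hspan : ∀ x ∈ K.stage 1, ∃ c : Bool → ℚ, x = ∑ b, c b • (bif b then K.wNat 0 else 1) := by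
    intro x hx
    obtain ⟨v, rfl⟩ := exists_of_mem_translates (f := K.stageFactor 0) (V := K.stage 0) hx
    choose c hc using fun k => Submodule.mem_span_singleton.mp (v k).2
    refine ⟨fun b => bif b then c (some none) else c none, ?_⟩
    simp [hsum, stageFactor, ← hc, add_comm]
  refine ⟨hmem, hd, ?_, ?_⟩
  · intro x hx _
    obtain ⟨c, rfl⟩ := hspan x hx
    exact ⟨c, 0, zero_mem _, by simp⟩
  · intro c v hv hcv
    obtain ⟨c', rfl⟩ := hspan v hv
    have hinj := K.combination_injective hn (f := K.stageFactor 0) (by simp) rfl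
    have one_ne : (1 : E) ≠ 0 := fun h => by
      have hs : Subsingleton E := subsingleton_of_zero_eq_one h.symm
      have hr := K.finrank_stage hn.le
      simp [Module.finrank_zero_of_subsingleton] at hr
    let a : Option (Option (Fin 0)) → K.stage 0 := fun o =>
      ⟨(o.elim (c false) fun _ => c true) • 1, Submodule.smul_mem _ _ (one_mem_stage 0)⟩
    have ha : a = 0 := hinj (by
      simp only [map_sum, map_smul, hd, smul_zero, Finset.sum_const_zero] at hcv
      rw [map_zero, combination_apply, hsum]
      simpa [stageFactor, a, add_comm] using hcv)
    have key : ∀ o : Option (Option (Fin 0)), (o.elim (c false) fun _ => c true) = 0 := fun o =>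
      (smul_eq_zero.mp (congrArg Subtype.val (congrFun ha o))).resolve_right one_ne
    rintro (_ | _)
    · exact key none
    · exact key (some none)

/-- The element of bidegree `(1, 1)` with differential `-2 w 0`. -/
def triangle : E := K.gNat 1 2 - K.gNat 0 2 - K.gNat 0 1

theorem triangle_mem : K.triangle ∈ K.comp 1 1 :=
  sub_mem (sub_mem (K.gNat_mem (by omega)) (K.gNat_mem (by omega))) (K.gNat_mem (by omega))

theorem d_triangle (hn : 3 ≤ n) : K.d K.triangle = (-2 : ℚ) • K.wNat 0 := by
  rw [triangle, map_sub, map_sub, K.d_gNat (by omega) (by omega) (by omega),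
    K.d_gNat (by omega) (by omega) (by omega), K.d_gNat (by omega) (by omega) (by omega)]
  module

theorem triangle_mul_mem {m : ℕ} (hm : 3 ≤ m) : ∀ v ∈ K.stage m, K.triangle * v ∈ K.stage m := by
  intro v hv
  rw [triangle, sub_mul, sub_mul]
  exact sub_mem (sub_mem (gNat_mul_mem (by omega) (by omega) v hv)
    (gNat_mul_mem (by omega) (by omega) v hv)) (gNat_mul_mem (by omega) (by omega) v hv)

theorem d_wNat_add_mul (m : ℕ) (x : E) :
    K.d ((K.wNat m + K.wNat 0) * x) = (K.wNat m + K.wNat 0) * K.d x := by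
  simp only [add_mul, map_add, d_wNat_mul]

theorem d_gNat_zero_mul {m : ℕ} (hm : m + 1 < n) (x : E) :
    K.d (K.gNat 0 (m + 1) * x) =
      (K.wNat (m + 1) + K.wNat 0) * x - K.gNat 0 (m + 1) * K.d x := by
  rw [K.d_mul_of_mem_comp_one (K.gNat_mem (by omega)), K.d_gNat (by omega) (by omega) hm,
    add_comm (K.wNat 0)]

theorem isCohomologyBasis_stage_two (hn : 2 ≤ n) :
    IsCohomologyBasis K.d (K.stage 2) (fun b : Bool => bif b then K.wNat 0 else 1) := by
  have hτ : ∀ i : Fin 0, ∀ v ∈ K.stage (0 + 1), (0 : Fin 0 → E) i * v ∈ K.stage (0 + 1) :=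
    fun i => i.elim0
  have htr := K.translates_adaptedFactor 0 hτ
  have H := (K.isCohomologyBasis_stage_one (by omega)).extend
    (K.combination_injective (m := 1) (by omega) (by simp) htr) (d_mem_stage (by omega))
    (K.d_wNat_add_mul 1) (K.d_gNat_zero_mul (by omega)) (fun i => i.elim0)
  rw [htr] at H
  convert H.reindex (Equiv.uniqueProd Bool (Option (Fin 0))).symm using 1
  funext b
  exact (one_mul _).symm

theorem isCohomologyBasis_stage_three (hn : 3 ≤ n) :
    IsCohomologyBasis K.d (K.stage 3)
      (fun b : Bool => bif b then K.triangle * K.wNat 0 else 1) := by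
  have hτ : ∀ i : Fin 1, ∀ v ∈ K.stage (1 + 1),
      (fun _ => K.gNat 0 1 : Fin 1 → E) i * v ∈ K.stage (1 + 1) :=
    fun _ => gNat_mul_mem (by omega) (by omega)
  have htr := K.translates_adaptedFactor 1 hτ
  have hz : K.correctedG 1 (fun _ => K.gNat 0 1) = fun _ => K.triangle := by
    funext i
    rw [Subsingleton.elim i 0]
    rfl
  rw [hz] at htr
  have H := (K.isCohomologyBasis_stage_two (by omega)).extend_twisted
    (K.combination_injective (m := 2) (by omega) (by simp) htr) (d_mem_stage (by omega))
    (K.d_wNat_add_mul 2) (K.d_gNat_zero_mul (by omega))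
    (fun x => by
      rw [K.d_mul_of_mem_comp_one K.triangle_mem, K.d_triangle hn, smul_mul_assoc])
    (K.d_wNat_mul 0) (wNat_mul_mem (by omega)) (K.wNat_mul_self 0)
  rwa [htr] at H

/-- Corrections making the generators of a new point closed. -/
def correction (m : ℕ) (i : Fin m) : E := K.gNat 0 (i + 1) + K.triangle

theorem correctedG_mem (m : ℕ) (i : Fin m) :
    K.correctedG m (K.correction m) i ∈ K.comp 1 1 :=
  sub_mem (sub_mem (K.gNat_mem (by omega)) (K.gNat_mem (by omega)))
    (add_mem (K.gNat_mem (by omega)) K.triangle_mem)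

theorem d_correctedG {m : ℕ} (hm : m + 1 < n) (i : Fin m) :
    K.d (K.correctedG m (K.correction m) i) = 0 := by
  have hi := i.2
  rw [correctedG, correction, map_sub, map_sub, map_add, K.d_triangle (by omega),
    K.d_gNat (by omega) (by omega) (by omega), K.d_gNat (by omega) (by omega) (by omega),
    K.d_gNat (by omega) (by omega) (by omega)]
  module

theorem isCohomologyBasis_stage_succ {m : ℕ} (hm : m + 1 < n) (hm2 : 2 ≤ m)
    {ι : Type*} [Fintype ι] {h : ι → E} (H : IsCohomologyBasis K.d (K.stage (m + 1)) h) :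
    IsCohomologyBasis K.d (K.stage (m + 2))
      (extendClasses (K.correctedG m (K.correction m)) h) := by
  have hτ : ∀ i, ∀ v ∈ K.stage (m + 1), K.correction m i * v ∈ K.stage (m + 1) := by
    intro i v hv
    rw [correction, add_mul]
    exact add_mem (gNat_mul_mem (by omega) (by omega) v hv) (K.triangle_mul_mem (by omega) v hv)
  have htr := K.translates_adaptedFactor m hτ
  have := H.extend (K.combination_injective hm (by simp) htr) (d_mem_stage hm.le)
    (K.d_wNat_add_mul (m + 1)) (K.d_gNat_zero_mul hm)
    (fun i x => by
      rw [K.d_mul_of_mem_comp_one (K.correctedG_mem m i), K.d_correctedG hm]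
      simp)
  rwa [htr] at this

/-- A homogeneous basis of the cohomology of the stages, sorted by the factor `1` or
`triangle * w 0` and by the number `r` of further generators. -/
theorem exists_isCohomologyBasis_stage (p : ℕ) (hp : p + 3 ≤ n) :
    ∃ (ι : Type) (_ : Fintype ι) (r : ι → ℕ) (h : Bool × ι → E),
      (∀ t, h t ∈ K.comp (r t.2 + t.1.toNat) (r t.2 + 3 * t.1.toNat)) ∧
      (∀ t, r t ≤ p) ∧ (∀ a ≤ p, ∃ t, r t = a) ∧
      (∀ x : MvPolynomial (Fin 2) ℚ,
        ∑ t, x ^ r t = ∏ j ∈ Finset.Icc 2 (p + 1), (1 + MvPolynomial.C (j : ℚ) * x)) ∧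
      IsCohomologyBasis K.d (K.stage (p + 3)) h := by
  induction p with
  | zero =>
    refine ⟨Unit, inferInstance, fun _ => 0, fun t => bif t.1 then K.triangle * K.wNat 0 else 1,
      ?_, by simp, by simp, by simp, ?_⟩
    · rintro ⟨_ | _, _⟩
      · exact K.one_mem
      · show K.triangle * K.wNat 0 ∈ K.comp (1 + 0) (1 + 2)
        exact K.mul_mem K.triangle_mem (K.wNat_mem 0)
    · exact (K.isCohomologyBasis_stage_three hp).reindex (Equiv.prodPUnit Bool)
  | succ p ih =>
    obtain ⟨ι, _, r, h, hdeg, hr, hr', hsum, H⟩ := ih (by omega)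
    let z := K.correctedG (p + 2) (K.correction (p + 2))
    let e : Bool × (Option (Fin (p + 2)) × ι) ≃ Option (Fin (p + 2)) × (Bool × ι) :=
      ⟨fun t => (t.2.1, t.1, t.2.2), fun t => (t.2.1, t.1, t.2.2), fun _ => rfl, fun _ => rfl⟩
    refine ⟨Option (Fin (p + 2)) × ι, inferInstance, fun t => t.1.elim 0 (fun _ => 1) + r t.2,
      extendClasses z h ∘ e, ?_, ?_, ?_, ?_,
      (K.isCohomologyBasis_stage_succ (m := p + 2) (by omega) (by omega) H).reindex e⟩
    · rintro ⟨b, o, t⟩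
      rw [add_assoc, add_assoc]
      refine K.mul_mem ?_ (hdeg (b, t))
      cases o with
      | none => exact K.one_mem
      | some i => exact K.correctedG_mem _ i
    · rintro ⟨_ | i, t⟩
      · have := hr t
        simp only [Option.elim]
        omega
      · have := hr t
        simp only [Option.elim]
        omega
    · intro a ha
      rcases Nat.le_succ_iff.mp ha with ha | rfl
      · obtain ⟨t, ht⟩ := hr' a ha
        exact ⟨(none, t), by simp [ht]⟩
      · obtain ⟨t, ht⟩ := hr' p le_rfl
        exact ⟨(some 0, t), by simp [ht, add_comm]⟩
    · intro x
      rw [Finset.prod_Icc_succ_top (by omega), ← hsum]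
      simp only [Fintype.sum_prod_type, Fintype.sum_option, Option.elim, pow_add,
        pow_one, Finset.sum_const, Finset.card_univ, Fintype.card_fin, nsmul_eq_mul,
        ← Finset.mul_sum]
      push_cast
      simp only [map_add, map_natCast, map_one]
      ring

/-- The decomposition of `E` into its bigraded components. -/
noncomputable def decomposition : (DirectSum (ℕ × ℕ) fun qk => K.comp qk.1 qk.2) ≃ₗ[ℚ] E :=
  LinearEquiv.ofBijective (DirectSum.coeLinearMap fun qk : ℕ × ℕ => K.comp qk.1 qk.2) K.internal

/-- The projection of `E` onto its component of bidegree `(k, q)`. -/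
noncomputable def proj (q k : ℕ) : E →ₗ[ℚ] E :=
  (K.comp q k).subtype ∘ₗ
    DirectSum.component ℚ (ℕ × ℕ) (fun qk => K.comp qk.1 qk.2) (q, k) ∘ₗ
      K.decomposition.symm.toLinearMap

theorem proj_mem (q k : ℕ) (x : E) : K.proj q k x ∈ K.comp q k :=
  Subtype.coe_prop _

theorem proj_apply_of_mem {q k : ℕ} {x : E} (hx : x ∈ K.comp q k) (q' k' : ℕ) :
    K.proj q' k' x = if (q, k) = (q', k') then x else 0 := by
  have : K.decomposition.symm x =
      DirectSum.lof ℚ (ℕ × ℕ) (fun qk => K.comp qk.1 qk.2) (q, k) ⟨x, hx⟩ :=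
    (LinearEquiv.symm_apply_eq _).mpr
      (DirectSum.coeLinearMap_lof (fun qk : ℕ × ℕ => K.comp qk.1 qk.2) (q, k) ⟨x, hx⟩).symm
  simp only [proj, LinearMap.comp_apply, LinearEquiv.coe_coe, this]
  split_ifs with h
  · obtain ⟨rfl, rfl⟩ := Prod.mk.inj h
    rw [DirectSum.component.lof_self]
    rfl
  · rw [DirectSum.component.of, dif_neg h]
    rfl

theorem induction_comp {P : E → Prop} (h : ∀ q k, ∀ x ∈ K.comp q k, P x) (h0 : P 0)
    (hadd : ∀ x y, P x → P y → P (x + y)) (x : E) : P x := by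
  have hx : x ∈ ⨆ qk : ℕ × ℕ, K.comp qk.1 qk.2 := by
    rw [K.internal.submodule_iSup_eq_top]
    trivial
  exact Submodule.iSup_induction _ (motive := P) hx (fun qk y hy => h _ _ y hy) h0 hadd

theorem proj_d_mem_boundaries (q k : ℕ) (x : E) : K.proj q k (K.d x) ∈ K.boundaries q k := by
  refine K.induction_comp (P := fun x => K.proj q k (K.d x) ∈ K.boundaries q k) ?_ ?_ ?_ x
  · rintro (_ | q') k' x hx
    · rw [K.d_zero hx, map_zero]
      exact zero_mem _
    · rw [K.proj_apply_of_mem (K.d_mem hx)]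
      split_ifs with h
      · obtain ⟨rfl, rfl⟩ := Prod.mk.inj h
        exact ⟨x, hx, rfl⟩
      · exact zero_mem _
  · simp
  · intro x y hx hy
    rw [map_add, map_add]
    exact add_mem hx hy

theorem nonempty_equiv_H {ι : Type*} [Fintype ι] {h : ι → E}
    (H : IsCohomologyBasis K.d ⊤ h) {deg : ι → ℕ × ℕ}
    (hdeg : ∀ t, h t ∈ K.comp (deg t).1 (deg t).2) (q k : ℕ) :
    Nonempty (({t // deg t = (q, k)} → ℚ) ≃ₗ[ℚ] K.H q k) := by
  classical
  let b : {t // deg t = (q, k)} → K.cocycles q k := fun t =>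
    ⟨h t, by have := hdeg t; rwa [t.2] at this, H.d_eq_zero t⟩
  have hb : ∀ c : {t // deg t = (q, k)} → ℚ,
      ((Fintype.linearCombination ℚ b c : K.cocycles q k) : E) = ∑ t, c t • h t := by
    intro c
    simp [Fintype.linearCombination_apply, b]
  refine ⟨LinearEquiv.ofBijective
    ((Submodule.mkQ _) ∘ₗ Fintype.linearCombination ℚ b) ⟨?_, ?_⟩⟩
  · rw [← LinearMap.ker_eq_bot, LinearMap.ker_eq_bot']
    intro c hc
    rw [LinearMap.comp_apply, Submodule.mkQ_apply, Submodule.Quotient.mk_eq_zero] at hc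
    obtain ⟨v, -, hv⟩ := hc
    have hv : K.d v = ∑ t, c t • h t := hv.trans (hb c)
    let c' : ι → ℚ := fun s => if hs : deg s = (q, k) then c ⟨s, hs⟩ else 0
    have hc' : ∀ t : {t // deg t = (q, k)}, c' t = c t := fun t => dif_pos t.2
    have hsum : ∑ t, c' t • h t = ∑ t, c t • h t := by
      simp only [← hc']
      rw [← Finset.sum_subtype (Finset.univ.filter fun t => deg t = (q, k)) (by simp)
        (fun t => c' t • h t), Finset.sum_filter_of_ne]
      intro t _ ht
      by_contra hne
      exact ht (by simp [c', hne])
    funext t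
    rw [← hc', H.indep c' v trivial (hsum.trans hv.symm) t, Pi.zero_apply]
  · intro y
    obtain ⟨⟨x, hx⟩, rfl⟩ := Submodule.mkQ_surjective _ y
    obtain ⟨c, v, -, hc⟩ := H.span x trivial hx.2
    refine ⟨fun t => c t, ?_⟩
    rw [LinearMap.comp_apply, ← sub_eq_zero, ← map_sub, Submodule.mkQ_apply,
      Submodule.Quotient.mk_eq_zero]
    have hxp : x = ∑ t : {t // deg t = (q, k)}, c t • h t + K.proj q k (K.d v) := by
      have h1 := congrArg (K.proj q k) hc
      rw [K.proj_apply_of_mem hx.1, if_pos rfl, map_add, map_sum] at h1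
      rw [h1]
      congr 1
      simp only [map_smul, fun t => K.proj_apply_of_mem (hdeg t) q k, Prod.mk.eta, smul_ite,
        smul_zero]
      rw [← Finset.sum_filter]
      exact Finset.sum_subtype _ (by simp) _
    show ((Fintype.linearCombination ℚ b fun t => c t : K.cocycles q k) : E) - x ∈
      K.boundaries q k
    rw [hb, hxp, sub_add_cancel_left]
    exact neg_mem (K.proj_d_mem_boundaries q k v)

end Cohomology

variable {n : ℕ} {E : Type v} [Ring E] [Algebra ℚ E] (K : KrizCP1 n E)

/-- The cohomology of the Križ model described by a family of classes, sorted by the factor `1`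
or `triangle * w 0` and by the number `r` of further generators. -/
theorem exists_equiv_H (hn : 3 ≤ n) :
    ∃ (ι : Type) (_ : Fintype ι) (r : ι → ℕ), (∀ t, r t ≤ n - 3) ∧ (∀ a ≤ n - 3, ∃ t, r t = a) ∧
      (∀ x : MvPolynomial (Fin 2) ℚ,
        ∑ t, x ^ r t = ∏ j ∈ Finset.Icc 2 (n - 2), (1 + MvPolynomial.C (j : ℚ) * x)) ∧
      ∀ q k, Nonempty (({t : Bool × ι //
        (r t.2 + t.1.toNat, r t.2 + 3 * t.1.toNat) = (q, k)} → ℚ) ≃ₗ[ℚ] K.H q k) := by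
  obtain ⟨ι, hι, r, h, hdeg, hr, hr', hsum, H⟩ :=
    K.exists_isCohomologyBasis_stage (n - 3) (by omega)
  rw [show n - 3 + 1 = n - 2 by omega] at hsum
  rw [show n - 3 + 3 = n by omega, stage_eq_top] at H
  exact ⟨ι, hι, r, hr, hr', hsum, K.nonempty_equiv_H H hdeg⟩

end KrizCP1

open MvPolynomial in
/-- For `n ≥ 4`, the nonzero bigraded components of the cohomology of the configuration
space `F(ℂP¹,n)` (computed by the Križ model) are exactly `H_q^q` and `H_{q+1}^{q+3}` for
`q = 0, 1, …, n-3`, with `H_q^q ≅ H_{q+1}^{q+3}`; the two-variable Poincaré polynomial is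
`Σ (dim H_q^k)·t^k s^q = (1 + st³)(1 + 2st)(1 + 3st)⋯(1 + (n-2)st)`. -/
theorem cp1_configuration_cohomology (n : ℕ) (hn : 4 ≤ n)
    (E : Type v) [Ring E] [Algebra ℚ E] (K : KrizCP1 n E) :
    (∀ q k : ℕ, Nontrivial (K.H q k) ↔
      ((k = q ∧ q ≤ n - 3) ∨ (k = q + 2 ∧ 1 ≤ q ∧ q ≤ n - 2))) ∧
    (∀ q : ℕ, q ≤ n - 3 → Nonempty (K.H q q ≃ₗ[ℚ] K.H (q + 1) (q + 3))) ∧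
    (∑ q ∈ Finset.range (n + 1), ∑ k ∈ Finset.range (2 * n + 1),
        (Module.finrank ℚ (K.H q k) : MvPolynomial (Fin 2) ℚ) *
          (X 0 : MvPolynomial (Fin 2) ℚ) ^ k * (X 1 : MvPolynomial (Fin 2) ℚ) ^ q) =
      (1 + X 1 * (X 0) ^ 3) *
        ∏ j ∈ Finset.Icc 2 (n - 2),
          (1 + C (j : ℚ) * X 1 * X 0) := by
  classical
  obtain ⟨ι, _, r, hr, hr', hsum, e⟩ := K.exists_equiv_H (by omega)
  refine ⟨?_, ?_, ?_⟩
  · intro q k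
    obtain ⟨e⟩ := e q k
    rw [← e.toEquiv.nontrivial_congr]
    constructor
    · intro hnt
      have hne : Nonempty {t : Bool × ι //
          (r t.2 + t.1.toNat, r t.2 + 3 * t.1.toNat) = (q, k)} := by
        by_contra hempty
        rw [not_nonempty_iff] at hempty
        exact false_of_nontrivial_of_subsingleton ({t : Bool × ι //
          (r t.2 + t.1.toNat, r t.2 + 3 * t.1.toNat) = (q, k)} → ℚ)
      obtain ⟨⟨⟨b, t⟩, ht⟩⟩ := hne
      have := hr t
      cases b <;> simp at ht <;> omega
    · rintro (⟨rfl, hq⟩ | ⟨rfl, hq, hq'⟩)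
      · obtain ⟨t, rfl⟩ := hr' k hq
        have : Nonempty {s : Bool × ι //
          (r s.2 + s.1.toNat, r s.2 + 3 * s.1.toNat) = (r t, r t)} := ⟨⟨(false, t), by simp⟩⟩
        infer_instance
      · obtain ⟨t, ht⟩ := hr' (q - 1) (by omega)
        have : Nonempty {s : Bool × ι //
          (r s.2 + s.1.toNat, r s.2 + 3 * s.1.toNat) = (q, q + 2)} :=
            ⟨⟨(true, t), by simp; omega⟩⟩
        infer_instance
  · intro q _
    obtain ⟨e1⟩ := e q q
    obtain ⟨e2⟩ := e (q + 1) (q + 3)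
    refine ⟨e1.symm.trans ((LinearEquiv.funCongrLeft ℚ ℚ ?_).trans e2)⟩
    refine (Equiv.prodCongr Equiv.boolNot (Equiv.refl ι)).subtypeEquiv ?_
    rintro ⟨_ | _, t⟩ <;> simp; omega
  · have hfin : ∀ q k, (Module.finrank ℚ (K.H q k) : MvPolynomial (Fin 2) ℚ) =
        ∑ t : Bool × ι, if r t.2 + t.1.toNat = q then
          (if r t.2 + 3 * t.1.toNat = k then 1 else 0) else 0 := by
      intro q k
      obtain ⟨e⟩ := e q k
      rw [← e.finrank_eq, Module.finrank_fintype_fun_eq_card, Fintype.card_subtype,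
        Finset.card_filter]
      push_cast
      simp only [Prod.mk.injEq, ite_and]
    have hterm : ∀ t : Bool × ι,
        ∑ q ∈ Finset.range (n + 1), ∑ k ∈ Finset.range (2 * n + 1),
          (if r t.2 + t.1.toNat = q then (if r t.2 + 3 * t.1.toNat = k then 1 else 0) else 0) *
            (X 0 : MvPolynomial (Fin 2) ℚ) ^ k * (X 1 : MvPolynomial (Fin 2) ℚ) ^ q =
        X 0 ^ (r t.2 + 3 * t.1.toNat) * X 1 ^ (r t.2 + t.1.toNat) := by
      intro t
      have h1 := hr t.2
      have h2 := t.1.toNat_le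
      rw [Finset.sum_eq_single_of_mem (r t.2 + t.1.toNat) (Finset.mem_range.mpr (by omega)),
        Finset.sum_eq_single_of_mem (r t.2 + 3 * t.1.toNat) (Finset.mem_range.mpr (by omega))]
      · simp
      · intro k _ hk
        simp [hk.symm]
      · intro q _ hq
        simp [hq.symm]
    simp only [hfin, Finset.sum_mul]
    rw [Finset.sum_congr rfl fun q _ => Finset.sum_comm, Finset.sum_comm,
      Finset.sum_congr rfl fun t _ => hterm t]
    have hprod := hsum (X 1 * X 0)
    simp only [← mul_assoc] at hprod
    rw [← hprod, Fintype.sum_prod_type, Fintype.sum_bool, ← Finset.sum_add_distrib,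
      Finset.mul_sum]
    refine Finset.sum_congr rfl fun t _ => ?_
    simp only [Bool.toNat_true, Bool.toNat_false]
    ring
end

section
/- For the Križ model of CP^1 with n = 2 points, the only nonzero cohomology groups are H_0^0 and H_0^2, each one-dimensional over Q, and the nontrivial element of S_2 acts on H_0^2 by −1 (the sign representation). For n = 3 points, the only nonzero cohomology groups are H_0^0 and H_1^3, each one-dimensional over Q, and S_3 acts trivially on both. In particular the two-variable Poincaré polynomials are 1 + t² for n = 2 and 1 + st³ for n = 3. -/
universe v

namespace KrizCP1

open Module

variable {n : ℕ} {E : Type v} [Ring E] [Algebra ℚ E]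

/-- A homogeneous element is a combination of those members of a homogeneous spanning family
that have the same bidegree. -/
theorem exists_coeff_of_mem_comp (K : KrizCP1 n E) {ι : Type*} [Fintype ι] {M : ι → E}
    {deg : ι → ℕ × ℕ} (hM : ∀ c, M c ∈ K.comp (deg c).1 (deg c).2)
    (hspan : ⊤ ≤ Submodule.span ℚ (Set.range M)) {q k : ℕ} {x : E} (hx : x ∈ K.comp q k) :
    ∃ f : ι → ℚ, ∑ c with deg c = (q, k), f c • M c = x := by
  obtain ⟨f, rfl⟩ :=
    (Submodule.mem_span_range_iff_exists_fun ℚ).1 (hspan (Submodule.mem_top (x := x)))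
  refine ⟨f, ?_⟩
  have hsum := Finset.sum_filter_add_sum_filter_not Finset.univ (fun c => deg c = (q, k))
    fun c => f c • M c
  have hmem : ∑ c with deg c = (q, k), f c • M c ∈ K.comp q k := by
    refine Submodule.sum_mem _ fun c hc => Submodule.smul_mem _ _ ?_
    simpa [(Finset.mem_filter.1 hc).2] using hM c
  rw [← hsum, left_eq_add]
  refine Submodule.disjoint_def.1 (K.internal.submodule_iSupIndep (q, k)) _
    ((Submodule.add_mem_iff_right _ hmem).1 (hsum ▸ hx)) ?_
  exact Submodule.sum_mem _ fun c hc => Submodule.smul_mem _ _ (Submodule.mem_iSup_of_mem (deg c)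
    (Submodule.mem_iSup_of_mem (Finset.mem_filter.1 hc).2 (hM c)))

/-- A spanning family with as many members as there are canonical monomials is linearly
independent. -/
theorem linearIndependent_of_card_eq (K : KrizCP1 n E) {ι : Type*} [Fintype ι] {M : ι → E}
    (hspan : ⊤ ≤ Submodule.span ℚ (Set.range M))
    (hcard : Fintype.card ι = Fintype.card
      {Te : Finset (Fin n) × (Fin n → Option (Fin n)) //
        (∀ j i, Te.2 j = some i → i < j) ∧ (∀ j, Te.2 j ≠ none → j ∉ Te.1)}) :
    LinearIndependent ℚ M := by
  refine linearIndependent_of_top_le_span_of_card_eq_finrank hspan ?_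
  rw [hcard]
  refine (finrank_eq_card_basis (Basis.mk K.indep_canon ?_)).symm
  rw [← K.span_canon]
  refine Submodule.span_mono ?_
  rintro x ⟨T, e, h₁, h₂, rfl⟩
  exact ⟨⟨(T, e), h₁, h₂⟩, rfl⟩

theorem w_comm (K : KrizCP1 n E) (i j : Fin n) : K.w i * K.w j = K.w j * K.w i := by
  simpa [Even.neg_one_pow (by decide : Even 4)] using K.gcomm (K.w_mem i) (K.w_mem j)

theorem G_mul_w (K : KrizCP1 n E) {i j : Fin n} (h : i ≠ j) (k : Fin n) :
    K.G i j * K.w k = K.w k * K.G i j := by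
  simpa using K.gcomm (K.G_mem h) (K.w_mem k)

theorem d_w_mul (K : KrizCP1 n E) (i : Fin n) (x : E) : K.d (K.w i * x) = K.w i * K.d x := by
  simpa [K.d_w] using K.leibniz (K.w_mem i) x

theorem d_G_mul (K : KrizCP1 n E) {i j : Fin n} (h : i ≠ j) (x : E) :
    K.d (K.G i j * x) = (K.w i + K.w j) * x - K.G i j * K.d x := by
  simpa [K.d_G h, sub_eq_add_neg] using K.leibniz (K.G_mem h) x

theorem d_one_s18 (K : KrizCP1 n E) : K.d 1 = 0 := K.d_zero K.one_mem

theorem w_sq_mul (K : KrizCP1 n E) (i : Fin n) (x : E) : K.w i * (K.w i * x) = 0 := by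
  rw [← mul_assoc, K.w_sq, zero_mul]

theorem subsingleton_H (K : KrizCP1 n E) {q k : ℕ}
    (h : ∀ x ∈ K.comp q k, K.d x = 0 → x ∈ K.boundaries q k) : Subsingleton (K.H q k) := by
  rw [Submodule.Quotient.subsingleton_iff, eq_top_iff]
  rintro ⟨x, hx, hd⟩ -
  exact h x hx hd

theorem finrank_H_eq_one (K : KrizCP1 n E) {q k : ℕ} {z : E} (hz : z ∈ K.cocycles q k)
    (hz' : z ∉ K.boundaries q k)
    (h : ∀ x ∈ K.comp q k, K.d x = 0 → ∃ c : ℚ, x - c • z ∈ K.boundaries q k) :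
    finrank ℚ (K.H q k) = 1 := by
  refine finrank_eq_one (Submodule.Quotient.mk ⟨z, hz⟩) ?_ ?_
  · rw [Ne, Submodule.Quotient.mk_eq_zero]
    exact hz'
  · intro y
    obtain ⟨⟨x, hx, hd⟩, rfl⟩ := Submodule.Quotient.mk_surjective _ y
    obtain ⟨c, hc⟩ := h x hx hd
    refine ⟨c, ?_⟩
    rw [← Submodule.Quotient.mk_smul, eq_comm, Submodule.Quotient.eq]
    exact hc

theorem d_mem_boundaries (K : KrizCP1 n E) {q k : ℕ} {y : E} (hy : y ∈ K.comp (q + 1) k) :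
    K.d y ∈ K.boundaries q (k + 1) :=
  Submodule.mem_map_of_mem hy

/-- The six canonical monomials for two points. -/
def mon₂ (K : KrizCP1 2 E) : Fin 6 → E :=
  ![1, K.w 0, K.w 1, K.w 0 * K.w 1, K.G 0 1, K.w 0 * K.G 0 1]

/-- The bidegrees (exterior degree, total degree) of the monomials `mon₂`. -/
def deg₂ : Fin 6 → ℕ × ℕ := ![(0, 0), (0, 2), (0, 2), (0, 4), (1, 1), (1, 3)]

theorem mon₂_mem (K : KrizCP1 2 E) (c : Fin 6) :
    K.mon₂ c ∈ K.comp (deg₂ c).1 (deg₂ c).2 := by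
  have hG : K.G 0 1 ∈ K.comp 1 1 := K.G_mem (by decide)
  fin_cases c
  exacts [K.one_mem, K.w_mem 0, K.w_mem 1, K.mul_mem (K.w_mem 0) (K.w_mem 1), hG,
    K.mul_mem (K.w_mem 0) hG]

theorem span_mon₂ (K : KrizCP1 2 E) : ⊤ ≤ Submodule.span ℚ (Set.range K.mon₂) := by
  rw [← K.span_canon]
  refine Submodule.span_mono ?_
  rintro x ⟨T, e, h₁, h₂, rfl⟩
  have e₀ : e 0 = none := by
    rcases h : e 0 with _ | i
    · rfl
    · exact absurd (h₁ 0 i h) (by simp)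
  have e₁ : e 1 = none ∨ e 1 = some 0 := by
    rcases h : e 1 with _ | i
    · simp
    · have := h₁ 1 i h
      right; congr; omega
  simp only [mon₂, Matrix.range_cons, Matrix.range_empty]
  have h₁' := h₂ 1
  by_cases t₀ : 0 ∈ T <;> by_cases t₁ : 1 ∈ T <;> rcases e₁ with e₁ | e₁ <;>
    simp_all [List.ofFn_succ, krizGprod, List.finRange_succ]

theorem linearIndependent_mon₂ (K : KrizCP1 2 E) : LinearIndependent ℚ K.mon₂ :=
  K.linearIndependent_of_card_eq K.span_mon₂ (by decide +kernel)

/-- The canonical monomials for three points. -/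
def mon₃ (K : KrizCP1 3 E) : Fin 24 → E :=
  ![1, K.w 0, K.w 1, K.w 2,
    K.w 0 * K.w 1, K.w 0 * K.w 2, K.w 1 * K.w 2, K.w 0 * (K.w 1 * K.w 2),
    K.G 0 1, K.G 0 2, K.G 1 2,
    K.w 0 * K.G 0 1, K.w 2 * K.G 0 1, K.w 0 * K.G 0 2, K.w 1 * K.G 0 2,
    K.w 0 * K.G 1 2, K.w 1 * K.G 1 2,
    K.w 0 * (K.w 2 * K.G 0 1), K.w 0 * (K.w 1 * K.G 0 2), K.w 0 * (K.w 1 * K.G 1 2),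
    K.G 0 1 * K.G 0 2, K.G 0 1 * K.G 1 2,
    K.w 0 * (K.G 0 1 * K.G 0 2), K.w 0 * (K.G 0 1 * K.G 1 2)]

/-- The bidegrees (exterior degree, total degree) of the monomials `mon₃`. -/
def deg₃ : Fin 24 → ℕ × ℕ :=
  ![(0, 0), (0, 2), (0, 2), (0, 2), (0, 4), (0, 4), (0, 4), (0, 6),
    (1, 1), (1, 1), (1, 1), (1, 3), (1, 3), (1, 3), (1, 3), (1, 3), (1, 3),
    (1, 5), (1, 5), (1, 5), (2, 2), (2, 2), (2, 4), (2, 4)]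

theorem mon₃_mem (K : KrizCP1 3 E) (c : Fin 24) :
    K.mon₃ c ∈ K.comp (deg₃ c).1 (deg₃ c).2 := by
  have h₀ := K.w_mem 0
  have h₁ := K.w_mem 1
  have h₂ := K.w_mem 2
  have g₀₁ : K.G 0 1 ∈ K.comp 1 1 := K.G_mem (by decide)
  have g₀₂ : K.G 0 2 ∈ K.comp 1 1 := K.G_mem (by decide)
  have g₁₂ : K.G 1 2 ∈ K.comp 1 1 := K.G_mem (by decide)
  fin_cases c
  exacts [K.one_mem, h₀, h₁, h₂, K.mul_mem h₀ h₁, K.mul_mem h₀ h₂, K.mul_mem h₁ h₂,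
    K.mul_mem h₀ (K.mul_mem h₁ h₂), g₀₁, g₀₂, g₁₂,
    K.mul_mem h₀ g₀₁, K.mul_mem h₂ g₀₁, K.mul_mem h₀ g₀₂, K.mul_mem h₁ g₀₂,
    K.mul_mem h₀ g₁₂, K.mul_mem h₁ g₁₂,
    K.mul_mem h₀ (K.mul_mem h₂ g₀₁), K.mul_mem h₀ (K.mul_mem h₁ g₀₂),
    K.mul_mem h₀ (K.mul_mem h₁ g₁₂), K.mul_mem g₀₁ g₀₂, K.mul_mem g₀₁ g₁₂,
    K.mul_mem h₀ (K.mul_mem g₀₁ g₀₂), K.mul_mem h₀ (K.mul_mem g₀₁ g₁₂)]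

theorem span_mon₃ (K : KrizCP1 3 E) : ⊤ ≤ Submodule.span ℚ (Set.range K.mon₃) := by
  rw [← K.span_canon]
  refine Submodule.span_mono ?_
  rintro x ⟨T, e, h₁, h₂, rfl⟩
  have e₀ : e 0 = none := by
    rcases h : e 0 with _ | i
    · rfl
    · exact absurd (h₁ 0 i h) (by simp)
  have e₁ : e 1 = none ∨ e 1 = some 0 := by
    rcases h : e 1 with _ | i
    · simp
    · have := h₁ 1 i h
      right; congr; omega
  have e₂ : e 2 = none ∨ e 2 = some 0 ∨ e 2 = some 1 := by
    rcases h : e 2 with _ | i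
    · simp
    · have := h₁ 2 i h
      have : i = 0 ∨ i = 1 := by omega
      rcases this with rfl | rfl <;> simp
  have t₁ : e 1 ≠ none → 1 ∉ T := h₂ 1
  have t₂ : e 2 ≠ none → 2 ∉ T := h₂ 2
  clear h₁ h₂
  rw [mon₃, krizGprod]
  simp only [Matrix.range_cons, Matrix.range_empty, Set.union_empty, Set.singleton_union,
    List.finRange_succ, List.finRange_zero, List.ofFn_succ, List.ofFn_zero, List.map_cons,
    List.map_nil, Fin.succ_zero_eq_one, Fin.succ_one_eq_two, Fin.isValue]
  rcases e₁ with e₁ | e₁ <;> rcases e₂ with e₂ | e₂ | e₂ <;>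
    simp only [e₁, e₂, ne_eq, reduceCtorEq, not_true_eq_false, not_false_eq_true,
      false_imp_iff, true_imp_iff] at t₁ t₂ <;>
    by_cases h₀ : 0 ∈ T <;> by_cases h₁ : 1 ∈ T <;> by_cases h₂ : 2 ∈ T <;>
    first
    | exact absurd h₁ t₁
    | exact absurd h₂ t₂
    | simp only [e₀, e₁, e₂, h₀, h₁, h₂, if_true, if_false, Option.map_none, Option.map_some,
        List.filterMap_cons, List.filterMap_nil, List.prod_cons, List.prod_nil, mul_one, one_mul,
        mul_assoc, Set.mem_insert_iff, Set.mem_singleton_iff, true_or, or_true]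

theorem linearIndependent_mon₃ (K : KrizCP1 3 E) : LinearIndependent ℚ K.mon₃ :=
  K.linearIndependent_of_card_eq K.span_mon₃ (by decide +kernel)

theorem exists_coeff₂ (K : KrizCP1 2 E) {q k : ℕ} {x : E} (hx : x ∈ K.comp q k) :
    ∃ f : Fin 6 → ℚ, ∑ c with deg₂ c = (q, k), f c • K.mon₂ c = x :=
  K.exists_coeff_of_mem_comp K.mon₂_mem K.span_mon₂ hx

theorem exists_coeff₃ (K : KrizCP1 3 E) {q k : ℕ} {x : E} (hx : x ∈ K.comp q k) :
    ∃ f : Fin 24 → ℚ, ∑ c with deg₃ c = (q, k), f c • K.mon₃ c = x :=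
  K.exists_coeff_of_mem_comp K.mon₃_mem K.span_mon₃ hx

theorem bidegree₂ (K : KrizCP1 2 E) {q k : ℕ} {x : E} (hx : x ∈ K.comp q k) (h : x ≠ 0) :
    (q = 0 ∧ k = 0) ∨ (q = 0 ∧ k = 2) ∨ (q = 0 ∧ k = 4) ∨ (q = 1 ∧ k = 1) ∨ (q = 1 ∧ k = 3) := by
  obtain ⟨f, rfl⟩ := K.exists_coeff₂ hx
  obtain ⟨c, hc, -⟩ := Finset.exists_ne_zero_of_sum_ne_zero h
  rw [Finset.mem_filter] at hc
  have hc := hc.2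
  fin_cases c <;> simp [deg₂] at hc <;> omega

theorem bidegree₃ (K : KrizCP1 3 E) {q k : ℕ} {x : E} (hx : x ∈ K.comp q k) (h : x ≠ 0) :
    (q = 0 ∧ k = 0) ∨ (q = 0 ∧ k = 2) ∨ (q = 0 ∧ k = 4) ∨ (q = 0 ∧ k = 6) ∨
      (q = 1 ∧ k = 1) ∨ (q = 1 ∧ k = 3) ∨ (q = 1 ∧ k = 5) ∨ (q = 2 ∧ k = 2) ∨
      (q = 2 ∧ k = 4) := by
  obtain ⟨f, rfl⟩ := K.exists_coeff₃ hx
  obtain ⟨c, hc, -⟩ := Finset.exists_ne_zero_of_sum_ne_zero h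
  rw [Finset.mem_filter] at hc
  have hc := hc.2
  fin_cases c <;> simp [deg₃] at hc <;> omega

theorem exists_coeff₂_zero_zero (K : KrizCP1 2 E) {x : E}
    (hx : x ∈ K.comp 0 0) :
    ∃ a : ℚ, x = a • 1 := by
  obtain ⟨t, rfl⟩ := K.exists_coeff₂ hx
  rw [show Finset.univ.filter (fun c => deg₂ c = (0, 0)) = {0}
    by decide +kernel]
  exact ⟨t 0, by simp [mon₂]⟩

theorem exists_coeff₂_zero_two (K : KrizCP1 2 E) {x : E}
    (hx : x ∈ K.comp 0 2) :
    ∃ a b : ℚ, x = a • K.w 0 + b • K.w 1 := by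
  obtain ⟨t, rfl⟩ := K.exists_coeff₂ hx
  rw [show Finset.univ.filter (fun c => deg₂ c = (0, 2)) = {1, 2}
    by decide +kernel]
  exact ⟨t 1, t 2, by simp [mon₂]⟩

theorem exists_coeff₂_zero_four (K : KrizCP1 2 E) {x : E}
    (hx : x ∈ K.comp 0 4) :
    ∃ a : ℚ, x = a • (K.w 0 * K.w 1) := by
  obtain ⟨t, rfl⟩ := K.exists_coeff₂ hx
  rw [show Finset.univ.filter (fun c => deg₂ c = (0, 4)) = {3}
    by decide +kernel]
  exact ⟨t 3, by simp [mon₂]⟩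

theorem exists_coeff₂_one_one (K : KrizCP1 2 E) {x : E}
    (hx : x ∈ K.comp 1 1) :
    ∃ a : ℚ, x = a • K.G 0 1 := by
  obtain ⟨t, rfl⟩ := K.exists_coeff₂ hx
  rw [show Finset.univ.filter (fun c => deg₂ c = (1, 1)) = {4}
    by decide +kernel]
  exact ⟨t 4, by simp [mon₂]⟩

theorem exists_coeff₂_one_three (K : KrizCP1 2 E) {x : E}
    (hx : x ∈ K.comp 1 3) :
    ∃ a : ℚ, x = a • (K.w 0 * K.G 0 1) := by
  obtain ⟨t, rfl⟩ := K.exists_coeff₂ hx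
  rw [show Finset.univ.filter (fun c => deg₂ c = (1, 3)) = {5}
    by decide +kernel]
  exact ⟨t 5, by simp [mon₂]⟩

theorem coeff_eq_zero₂_zero_two (K : KrizCP1 2 E) {a b : ℚ}
    (h : a • K.w 0 + b • K.w 1 = 0) :
    a = 0 ∧ b = 0 := by
  have := Fintype.linearIndependent_iff.1
    (K.linearIndependent_mon₂.comp ![1, 2] (by decide +kernel))
    ![a, b] (by simpa [Fin.sum_univ_succ, mon₂, add_assoc] using h)
  exact ⟨this 0, this 1⟩

theorem coeff_eq_zero₂_zero_four (K : KrizCP1 2 E) {a : ℚ}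
    (h : a • (K.w 0 * K.w 1) = 0) :
    a = 0 := by
  have := Fintype.linearIndependent_iff.1
    (K.linearIndependent_mon₂.comp ![3] (by decide +kernel))
    ![a] (by simpa [Fin.sum_univ_succ, mon₂, add_assoc] using h)
  exact this 0

theorem exists_coeff₃_zero_zero (K : KrizCP1 3 E) {x : E}
    (hx : x ∈ K.comp 0 0) :
    ∃ a : ℚ, x = a • 1 := by
  obtain ⟨t, rfl⟩ := K.exists_coeff₃ hx
  rw [show Finset.univ.filter (fun c => deg₃ c = (0, 0)) = {0}
    by decide +kernel]
  exact ⟨t 0, by simp [mon₃]⟩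

theorem exists_coeff₃_zero_two (K : KrizCP1 3 E) {x : E}
    (hx : x ∈ K.comp 0 2) :
    ∃ a b c : ℚ, x = a • K.w 0 + b • K.w 1 + c • K.w 2 := by
  obtain ⟨t, rfl⟩ := K.exists_coeff₃ hx
  rw [show Finset.univ.filter (fun c => deg₃ c = (0, 2)) = {1, 2, 3}
    by decide +kernel]
  exact ⟨t 1, t 2, t 3, by simp [mon₃, add_assoc]⟩

theorem exists_coeff₃_zero_four (K : KrizCP1 3 E) {x : E}
    (hx : x ∈ K.comp 0 4) :
    ∃ a b c : ℚ, x = a • (K.w 0 * K.w 1) + b • (K.w 0 * K.w 2) + c • (K.w 1 * K.w 2) := by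
  obtain ⟨t, rfl⟩ := K.exists_coeff₃ hx
  rw [show Finset.univ.filter (fun c => deg₃ c = (0, 4)) = {4, 5, 6}
    by decide +kernel]
  exact ⟨t 4, t 5, t 6, by simp [mon₃, add_assoc]⟩

theorem exists_coeff₃_zero_six (K : KrizCP1 3 E) {x : E}
    (hx : x ∈ K.comp 0 6) :
    ∃ a : ℚ, x = a • (K.w 0 * (K.w 1 * K.w 2)) := by
  obtain ⟨t, rfl⟩ := K.exists_coeff₃ hx
  rw [show Finset.univ.filter (fun c => deg₃ c = (0, 6)) = {7}
    by decide +kernel]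
  exact ⟨t 7, by simp [mon₃]⟩

theorem exists_coeff₃_one_one (K : KrizCP1 3 E) {x : E}
    (hx : x ∈ K.comp 1 1) :
    ∃ a b c : ℚ, x = a • K.G 0 1 + b • K.G 0 2 + c • K.G 1 2 := by
  obtain ⟨t, rfl⟩ := K.exists_coeff₃ hx
  rw [show Finset.univ.filter (fun c => deg₃ c = (1, 1)) = {8, 9, 10}
    by decide +kernel]
  exact ⟨t 8, t 9, t 10, by simp [mon₃, add_assoc]⟩

theorem exists_coeff₃_one_three (K : KrizCP1 3 E) {x : E}
    (hx : x ∈ K.comp 1 3) :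
    ∃ a b c d e f : ℚ, x = a • (K.w 0 * K.G 0 1) + b • (K.w 2 * K.G 0 1) +
      c • (K.w 0 * K.G 0 2) + d • (K.w 1 * K.G 0 2) +
      e • (K.w 0 * K.G 1 2) + f • (K.w 1 * K.G 1 2) := by
  obtain ⟨t, rfl⟩ := K.exists_coeff₃ hx
  rw [show Finset.univ.filter (fun c => deg₃ c = (1, 3)) = {11, 12, 13, 14, 15, 16}
    by decide +kernel]
  exact ⟨t 11, t 12, t 13, t 14, t 15, t 16, by simp [mon₃, add_assoc]⟩

theorem exists_coeff₃_one_five (K : KrizCP1 3 E) {x : E}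
    (hx : x ∈ K.comp 1 5) :
    ∃ a b c : ℚ, x = a • (K.w 0 * (K.w 2 * K.G 0 1)) +
      b • (K.w 0 * (K.w 1 * K.G 0 2)) + c • (K.w 0 * (K.w 1 * K.G 1 2)) := by
  obtain ⟨t, rfl⟩ := K.exists_coeff₃ hx
  rw [show Finset.univ.filter (fun c => deg₃ c = (1, 5)) = {17, 18, 19}
    by decide +kernel]
  exact ⟨t 17, t 18, t 19, by simp [mon₃, add_assoc]⟩

theorem exists_coeff₃_two_two (K : KrizCP1 3 E) {x : E}
    (hx : x ∈ K.comp 2 2) :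
    ∃ a b : ℚ, x = a • (K.G 0 1 * K.G 0 2) + b • (K.G 0 1 * K.G 1 2) := by
  obtain ⟨t, rfl⟩ := K.exists_coeff₃ hx
  rw [show Finset.univ.filter (fun c => deg₃ c = (2, 2)) = {20, 21}
    by decide +kernel]
  exact ⟨t 20, t 21, by simp [mon₃]⟩

theorem exists_coeff₃_two_four (K : KrizCP1 3 E) {x : E}
    (hx : x ∈ K.comp 2 4) :
    ∃ a b : ℚ, x = a • (K.w 0 * (K.G 0 1 * K.G 0 2)) +
      b • (K.w 0 * (K.G 0 1 * K.G 1 2)) := by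
  obtain ⟨t, rfl⟩ := K.exists_coeff₃ hx
  rw [show Finset.univ.filter (fun c => deg₃ c = (2, 4)) = {22, 23}
    by decide +kernel]
  exact ⟨t 22, t 23, by simp [mon₃]⟩

theorem coeff_eq_zero₃_zero_two (K : KrizCP1 3 E) {a b c : ℚ}
    (h : a • K.w 0 + b • K.w 1 + c • K.w 2 = 0) :
    a = 0 ∧ b = 0 ∧ c = 0 := by
  have := Fintype.linearIndependent_iff.1
    (K.linearIndependent_mon₃.comp ![1, 2, 3] (by decide +kernel))
    ![a, b, c] (by simpa [Fin.sum_univ_succ, mon₃, add_assoc] using h)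
  exact ⟨this 0, this 1, this 2⟩

theorem coeff_eq_zero₃_zero_four (K : KrizCP1 3 E) {a b c : ℚ}
    (h : a • (K.w 0 * K.w 1) + b • (K.w 0 * K.w 2) + c • (K.w 1 * K.w 2) = 0) :
    a = 0 ∧ b = 0 ∧ c = 0 := by
  have := Fintype.linearIndependent_iff.1
    (K.linearIndependent_mon₃.comp ![4, 5, 6] (by decide +kernel))
    ![a, b, c] (by simpa [Fin.sum_univ_succ, mon₃, add_assoc] using h)
  exact ⟨this 0, this 1, this 2⟩

theorem coeff_eq_zero₃_zero_six (K : KrizCP1 3 E) {a : ℚ}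
    (h : a • (K.w 0 * (K.w 1 * K.w 2)) = 0) :
    a = 0 := by
  have := Fintype.linearIndependent_iff.1
    (K.linearIndependent_mon₃.comp ![7] (by decide +kernel))
    ![a] (by simpa [Fin.sum_univ_succ, mon₃, add_assoc] using h)
  exact this 0

theorem coeff_eq_zero₃_one_three (K : KrizCP1 3 E) {a b c d e f : ℚ}
    (h : a • (K.w 0 * K.G 0 1) + b • (K.w 2 * K.G 0 1) +
      c • (K.w 0 * K.G 0 2) + d • (K.w 1 * K.G 0 2) +
      e • (K.w 0 * K.G 1 2) + f • (K.w 1 * K.G 1 2) = 0) :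
    a = 0 ∧ b = 0 ∧ c = 0 ∧ d = 0 ∧ e = 0 ∧ f = 0 := by
  have := Fintype.linearIndependent_iff.1
    (K.linearIndependent_mon₃.comp ![11, 12, 13, 14, 15, 16] (by decide +kernel))
    ![a, b, c, d, e, f] (by simpa [Fin.sum_univ_succ, mon₃, add_assoc] using h)
  exact ⟨this 0, this 1, this 2, this 3, this 4, this 5⟩

theorem coeff_eq_zero₃_one_five (K : KrizCP1 3 E) {a b c : ℚ}
    (h : a • (K.w 0 * (K.w 2 * K.G 0 1)) +
      b • (K.w 0 * (K.w 1 * K.G 0 2)) + c • (K.w 0 * (K.w 1 * K.G 1 2)) = 0) :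
    a = 0 ∧ b = 0 ∧ c = 0 := by
  have := Fintype.linearIndependent_iff.1
    (K.linearIndependent_mon₃.comp ![17, 18, 19] (by decide +kernel))
    ![a, b, c] (by simpa [Fin.sum_univ_succ, mon₃, add_assoc] using h)
  exact ⟨this 0, this 1, this 2⟩

theorem d_G₂ (K : KrizCP1 2 E) : K.d (K.G 0 1) = K.w 0 + K.w 1 := K.d_G (by decide)

theorem d_wG₂ (K : KrizCP1 2 E) : K.d (K.w 0 * K.G 0 1) = K.w 0 * K.w 1 := by
  rw [K.d_w_mul, K.d_G₂, mul_add, K.w_sq, zero_add]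

theorem one_ne_zero₂ (K : KrizCP1 2 E) : (1 : E) ≠ 0 := K.linearIndependent_mon₂.ne_zero 0

theorem finrank_H₂_zero_zero (K : KrizCP1 2 E) : finrank ℚ (K.H 0 0) = 1 := by
  refine K.finrank_H_eq_one ⟨K.one_mem, K.d_one_s18⟩ ?_ fun x hx _ => ?_
  · rintro ⟨y, hy, hd⟩
    have : y = 0 := by
      by_contra h
      have := K.bidegree₂ hy h
      omega
    rw [this, map_zero] at hd
    exact K.one_ne_zero₂ hd.symm
  · obtain ⟨a, rfl⟩ := K.exists_coeff₂_zero_zero hx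
    exact ⟨a, by simp⟩

theorem finrank_H₂_zero_two (K : KrizCP1 2 E) : finrank ℚ (K.H 0 2) = 1 := by
  refine K.finrank_H_eq_one ⟨K.w_mem 0, K.d_w 0⟩ ?_ fun x hx _ => ?_
  · rintro ⟨y, hy, hd⟩
    obtain ⟨a, rfl⟩ := K.exists_coeff₂_one_one hy
    rw [map_smul, K.d_G₂] at hd
    have := K.coeff_eq_zero₂_zero_two (a := a - 1) (b := a) (by rw [← sub_eq_zero.2 hd]; module)
    linarith
  · obtain ⟨a, b, rfl⟩ := K.exists_coeff₂_zero_two hx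
    refine ⟨a - b, b • K.G 0 1, Submodule.smul_mem _ _ (K.G_mem (by decide)), ?_⟩
    rw [map_smul, K.d_G₂]
    module

theorem subsingleton_H₂ (K : KrizCP1 2 E) (q k : ℕ) (h₀ : ¬(q = 0 ∧ k = 0))
    (h₂ : ¬(q = 0 ∧ k = 2)) : Subsingleton (K.H q k) := by
  refine K.subsingleton_H fun x hx hd => ?_
  by_cases h : x = 0
  · exact h ▸ Submodule.zero_mem _
  rcases K.bidegree₂ hx h with hqk | hqk | ⟨rfl, rfl⟩ | ⟨rfl, rfl⟩ | ⟨rfl, rfl⟩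
  · exact absurd hqk h₀
  · exact absurd hqk h₂
  · obtain ⟨a, rfl⟩ := K.exists_coeff₂_zero_four hx
    rw [← K.d_wG₂]
    exact Submodule.smul_mem _ _
      (K.d_mem_boundaries (K.mul_mem (K.w_mem 0) (K.G_mem (by decide))))
  · obtain ⟨a, rfl⟩ := K.exists_coeff₂_one_one hx
    rw [map_smul, K.d_G₂, smul_add] at hd
    simp [(K.coeff_eq_zero₂_zero_two hd).1]
  · obtain ⟨a, rfl⟩ := K.exists_coeff₂_one_three hx
    rw [map_smul, K.d_wG₂] at hd
    simp [K.coeff_eq_zero₂_zero_four hd]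

theorem act_swap_add_mem_boundaries (K : KrizCP1 2 E) {x : E} (hx : x ∈ K.cocycles 0 2) :
    K.act (Equiv.swap 0 1) x + x ∈ K.boundaries 0 2 := by
  obtain ⟨a, b, rfl⟩ := K.exists_coeff₂_zero_two hx.1
  refine ⟨(a + b) • K.G 0 1, Submodule.smul_mem _ _ (K.G_mem (by decide)), ?_⟩
  simp only [map_smul, map_add, K.d_G₂, K.act_w, Equiv.swap_apply_left, Equiv.swap_apply_right]
  module

theorem d_G_mul_G (K : KrizCP1 n E) {i j k l : Fin n} (h : i ≠ j) (h' : k ≠ l) :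
    K.d (K.G i j * K.G k l) =
      K.w i * K.G k l + K.w j * K.G k l - K.w k * K.G i j - K.w l * K.G i j := by
  rw [K.d_G_mul h, K.d_G h', mul_add, K.G_mul_w h, K.G_mul_w h, add_mul, sub_sub]

theorem d_G_mul_G_zero_two (K : KrizCP1 3 E) : K.d (K.G 0 1 * K.G 0 2) =
    K.w 0 * K.G 0 2 + K.w 1 * K.G 0 2 - K.w 0 * K.G 0 1 - K.w 2 * K.G 0 1 :=
  K.d_G_mul_G (by decide) (by decide)

theorem d_G_mul_G_one_two (K : KrizCP1 3 E) : K.d (K.G 0 1 * K.G 1 2) =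
    K.w 0 * K.G 1 2 + K.w 1 * K.G 1 2 - K.w 0 * K.G 0 1 - K.w 2 * K.G 0 1 := by
  rw [K.d_G_mul_G (by decide) (by decide), K.rel_p (by decide : (0 : Fin 3) ≠ 1)]

theorem d_w_mul_G (K : KrizCP1 n E) (k : Fin n) {i j : Fin n} (h : i ≠ j) :
    K.d (K.w k * K.G i j) = K.w k * K.w i + K.w k * K.w j := by
  rw [K.d_w_mul, K.d_G h, mul_add]

/-- The cocycle representing the generator of `H_1^3` for three points. -/
def top₃ (K : KrizCP1 3 E) : E := K.w 2 * K.G 0 1 - K.w 0 * K.G 0 2 - K.w 1 * K.G 1 2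

theorem top₃_mem_cocycles (K : KrizCP1 3 E) : K.top₃ ∈ K.cocycles 1 3 := by
  refine ⟨Submodule.sub_mem _ (Submodule.sub_mem _ ?_ ?_) ?_, ?_⟩
  · exact K.mul_mem (K.w_mem _) (K.G_mem (by decide))
  · exact K.mul_mem (K.w_mem _) (K.G_mem (by decide))
  · exact K.mul_mem (K.w_mem _) (K.G_mem (by decide))
  · change K.d K.top₃ = 0
    rw [top₃, map_sub, map_sub, K.d_w_mul_G _ (by decide),
      K.d_w_mul_G _ (by decide), K.d_w_mul_G _ (by decide), K.w_sq, K.w_sq, K.w_comm 2 0,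
      K.w_comm 2 1]
    abel

theorem top₃_notMem_boundaries (K : KrizCP1 3 E) : K.top₃ ∉ K.boundaries 1 3 := by
  rintro ⟨y, hy, hd⟩
  obtain ⟨p, q, rfl⟩ := K.exists_coeff₃_two_two hy
  rw [map_add, map_smul, map_smul, K.d_G_mul_G_zero_two, K.d_G_mul_G_one_two, top₃] at hd
  have := K.coeff_eq_zero₃_one_three (a := -p - q) (b := -p - q - 1) (c := p + 1) (d := p)
    (e := q) (f := q + 1) (by rw [← sub_eq_zero.2 hd]; module)
  linarith

theorem sub_smul_top₃_mem_boundaries (K : KrizCP1 3 E) {x : E} (hx : x ∈ K.cocycles 1 3) :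
    ∃ c : ℚ, x - c • K.top₃ ∈ K.boundaries 1 3 := by
  obtain ⟨hx, hd⟩ := hx
  obtain ⟨a, b, c, d, e, f, rfl⟩ := K.exists_coeff₃_one_three hx
  replace hd : K.d _ = 0 := hd
  simp only [map_add, map_smul, K.d_w_mul_G _ (by decide : (0 : Fin 3) ≠ 1),
    K.d_w_mul_G _ (by decide : (0 : Fin 3) ≠ 2), K.d_w_mul_G _ (by decide : (1 : Fin 3) ≠ 2),
    K.w_sq, K.w_comm 2 0, K.w_comm 2 1, K.w_comm 1 0] at hd
  obtain ⟨h₁, h₂, h₃⟩ := K.coeff_eq_zero₃_zero_four (a := a + d + e) (b := b + c + e)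
    (c := b + d + f) (by rw [← hd]; module)
  refine ⟨b + d + e, d • (K.G 0 1 * K.G 0 2) + e • (K.G 0 1 * K.G 1 2),
    Submodule.add_mem _ (Submodule.smul_mem _ _ ?_) (Submodule.smul_mem _ _ ?_), ?_⟩
  · exact K.mul_mem (K.G_mem (by decide)) (K.G_mem (by decide))
  · exact K.mul_mem (K.G_mem (by decide)) (K.G_mem (by decide))
  · obtain rfl : a = -d - e := by linarith
    obtain rfl : c = -b - e := by linarith
    obtain rfl : f = -b - d := by linarith
    rw [map_add, map_smul, map_smul, K.d_G_mul_G_zero_two, K.d_G_mul_G_one_two, top₃]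
    module

theorem one_ne_zero₃ (K : KrizCP1 3 E) : (1 : E) ≠ 0 := K.linearIndependent_mon₃.ne_zero 0

theorem finrank_H₃_zero_zero (K : KrizCP1 3 E) : finrank ℚ (K.H 0 0) = 1 := by
  refine K.finrank_H_eq_one ⟨K.one_mem, K.d_one_s18⟩ ?_ fun x hx _ => ?_
  · rintro ⟨y, hy, hd⟩
    have : y = 0 := by
      by_contra h
      have := K.bidegree₃ hy h
      omega
    rw [this, map_zero] at hd
    exact K.one_ne_zero₃ hd.symm
  · obtain ⟨a, rfl⟩ := K.exists_coeff₃_zero_zero hx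
    exact ⟨a, by simp⟩

theorem finrank_H₃_one_three (K : KrizCP1 3 E) : finrank ℚ (K.H 1 3) = 1 :=
  K.finrank_H_eq_one K.top₃_mem_cocycles K.top₃_notMem_boundaries
    fun _ hx hd => K.sub_smul_top₃_mem_boundaries ⟨hx, hd⟩

theorem subsingleton_H₃ (K : KrizCP1 3 E) (q k : ℕ) (h₀ : ¬(q = 0 ∧ k = 0))
    (h₁ : ¬(q = 1 ∧ k = 3)) : Subsingleton (K.H q k) := by
  refine K.subsingleton_H fun x hx hd => ?_
  by_cases h : x = 0
  · exact h ▸ Submodule.zero_mem _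
  have n₀₁ : (0 : Fin 3) ≠ 1 := by decide
  have n₀₂ : (0 : Fin 3) ≠ 2 := by decide
  have n₁₂ : (1 : Fin 3) ≠ 2 := by decide
  rcases K.bidegree₃ hx h with hqk | ⟨rfl, rfl⟩ | ⟨rfl, rfl⟩ | ⟨rfl, rfl⟩ | ⟨rfl, rfl⟩ | hqk |
    ⟨rfl, rfl⟩ | ⟨rfl, rfl⟩ | ⟨rfl, rfl⟩
  · exact absurd hqk h₀
  · obtain ⟨a, b, c, rfl⟩ := K.exists_coeff₃_zero_two hx
    refine ⟨((a + b - c) / 2) • K.G 0 1 + ((a + c - b) / 2) • K.G 0 2 +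
      ((b + c - a) / 2) • K.G 1 2, Submodule.add_mem _ (Submodule.add_mem _
        (Submodule.smul_mem _ _ (K.G_mem n₀₁)) (Submodule.smul_mem _ _ (K.G_mem n₀₂)))
        (Submodule.smul_mem _ _ (K.G_mem n₁₂)), ?_⟩
    rw [map_add, map_add, map_smul, map_smul, map_smul, K.d_G n₀₁, K.d_G n₀₂, K.d_G n₁₂]
    module
  · obtain ⟨a, b, c, rfl⟩ := K.exists_coeff₃_zero_four hx
    refine ⟨a • (K.w 0 * K.G 0 1) + b • (K.w 0 * K.G 0 2) + c • (K.w 1 * K.G 1 2),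
      Submodule.add_mem _ (Submodule.add_mem _
        (Submodule.smul_mem _ _ (K.mul_mem (K.w_mem 0) (K.G_mem n₀₁)))
        (Submodule.smul_mem _ _ (K.mul_mem (K.w_mem 0) (K.G_mem n₀₂))))
        (Submodule.smul_mem _ _ (K.mul_mem (K.w_mem 1) (K.G_mem n₁₂))), ?_⟩
    rw [map_add, map_add, map_smul, map_smul, map_smul, K.d_w_mul_G _ n₀₁, K.d_w_mul_G _ n₀₂,
      K.d_w_mul_G _ n₁₂, K.w_sq, K.w_sq]
    module
  · obtain ⟨a, rfl⟩ := K.exists_coeff₃_zero_six hx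
    refine ⟨a • (K.w 0 * (K.w 1 * K.G 1 2)), Submodule.smul_mem _ _
      (K.mul_mem (K.w_mem 0) (K.mul_mem (K.w_mem 1) (K.G_mem n₁₂))), ?_⟩
    rw [map_smul, K.d_w_mul, K.d_w_mul_G _ n₁₂, K.w_sq, zero_add]
  · obtain ⟨a, b, c, rfl⟩ := K.exists_coeff₃_one_one hx
    rw [map_add, map_add, map_smul, map_smul, map_smul, K.d_G n₀₁, K.d_G n₀₂, K.d_G n₁₂] at hd
    obtain ⟨h₁, h₂, h₃⟩ := K.coeff_eq_zero₃_zero_two (a := a + b) (b := a + c) (c := b + c)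
      (by rw [← hd]; module)
    obtain rfl : a = 0 := by linarith
    obtain rfl : b = 0 := by linarith
    obtain rfl : c = 0 := by linarith
    simp
  · exact absurd hqk h₁
  · obtain ⟨a, b, c, rfl⟩ := K.exists_coeff₃_one_five hx
    simp only [map_add, map_smul, K.d_w_mul, K.d_G n₀₁, K.d_G n₀₂, K.d_G n₁₂, mul_add, K.w_sq,
      K.w_sq_mul, K.w_comm 1 0, K.w_comm 2 0,
      K.w_comm 2 1, mul_zero] at hd
    have h := K.coeff_eq_zero₃_zero_six (a := a + b + c) (by rw [← hd]; module)
    obtain rfl : a = -b - c := by linarith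
    refine ⟨b • (K.w 0 * (K.G 0 1 * K.G 0 2)) + c • (K.w 0 * (K.G 0 1 * K.G 1 2)),
      Submodule.add_mem _
        (Submodule.smul_mem _ _ (K.mul_mem (K.w_mem 0) (K.mul_mem (K.G_mem n₀₁) (K.G_mem n₀₂))))
        (Submodule.smul_mem _ _ (K.mul_mem (K.w_mem 0) (K.mul_mem (K.G_mem n₀₁) (K.G_mem n₁₂)))),
      ?_⟩
    simp only [map_add, map_smul, K.d_w_mul, K.d_G_mul_G_zero_two, K.d_G_mul_G_one_two, mul_add,
      mul_sub, K.w_sq_mul]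
    module
  · obtain ⟨p, q, rfl⟩ := K.exists_coeff₃_two_two hx
    rw [map_add, map_smul, map_smul, K.d_G_mul_G_zero_two, K.d_G_mul_G_one_two] at hd
    obtain ⟨-, -, -, rfl, rfl, -⟩ := K.coeff_eq_zero₃_one_three (a := -p - q) (b := -p - q)
      (c := p) (d := p) (e := q) (f := q) (by rw [← hd]; module)
    simp
  · obtain ⟨p, q, rfl⟩ := K.exists_coeff₃_two_four hx
    simp only [map_add, map_smul, K.d_w_mul, K.d_G_mul_G_zero_two, K.d_G_mul_G_one_two, mul_add,
      mul_sub, K.w_sq_mul] at hd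
    obtain ⟨-, rfl, rfl⟩ := K.coeff_eq_zero₃_one_five (a := -p - q) (b := p) (c := q)
      (by rw [← hd]; module)
    simp

theorem d_G_mul_G_mem_boundaries (K : KrizCP1 n E) {i j k l : Fin n} (h : i ≠ j) (h' : k ≠ l) :
    K.d (K.G i j * K.G k l) ∈ K.boundaries 1 3 :=
  K.d_mem_boundaries (K.mul_mem (K.G_mem h) (K.G_mem h'))

theorem act_d_G_mul_G (K : KrizCP1 n E) (σ : Equiv.Perm (Fin n)) {i j k l : Fin n} (h : i ≠ j)
    (h' : k ≠ l) :
    K.act σ (K.d (K.G i j * K.G k l)) = K.d (K.G (σ i) (σ j) * K.G (σ k) (σ l)) := by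
  rw [K.d_G_mul_G h h', K.d_G_mul_G (σ.injective.ne h) (σ.injective.ne h')]
  simp only [map_sub, map_add, map_mul, K.act_w, K.act_G]

theorem act_mem_boundaries₃ (K : KrizCP1 3 E) (σ : Equiv.Perm (Fin 3)) {x : E}
    (hx : x ∈ K.boundaries 1 3) : K.act σ x ∈ K.boundaries 1 3 := by
  obtain ⟨y, hy, rfl⟩ := hx
  obtain ⟨p, q, rfl⟩ := K.exists_coeff₃_two_two hy
  have n₀₁ : (0 : Fin 3) ≠ 1 := by decide
  have n₀₂ : (0 : Fin 3) ≠ 2 := by decide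
  have n₁₂ : (1 : Fin 3) ≠ 2 := by decide
  rw [map_add, map_smul, map_smul, map_add, map_smul, map_smul, K.act_d_G_mul_G σ n₀₁ n₀₂,
    K.act_d_G_mul_G σ n₀₁ n₁₂]
  exact Submodule.add_mem _
    (Submodule.smul_mem _ _
      (K.d_G_mul_G_mem_boundaries (σ.injective.ne n₀₁) (σ.injective.ne n₀₂)))
    (Submodule.smul_mem _ _
      (K.d_G_mul_G_mem_boundaries (σ.injective.ne n₀₁) (σ.injective.ne n₁₂)))

theorem act_top₃_sub_mem_boundaries (K : KrizCP1 3 E) (σ : Equiv.Perm (Fin 3)) :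
    K.act σ K.top₃ - K.top₃ ∈ K.boundaries 1 3 := by
  have n₀₁ : (0 : Fin 3) ≠ 1 := by decide
  have n₀₂ : (0 : Fin 3) ≠ 2 := by decide
  have n₁₂ : (1 : Fin 3) ≠ 2 := by decide
  have hσ : σ ∈ Submonoid.closure (Set.range fun i : Fin 2 => Equiv.swap i.castSucc i.succ) :=
    Equiv.Perm.mclosure_swap_castSucc_succ 2 ▸ Submonoid.mem_top σ
  induction hσ using Submonoid.closure_induction with
  | mem τ hτ =>
    obtain ⟨i, rfl⟩ := hτ
    fin_cases i
    · have : K.act (Equiv.swap 0 1) K.top₃ = K.top₃ := by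
        simp only [top₃, map_sub, map_mul, K.act_w, K.act_G, Equiv.swap_apply_left,
          Equiv.swap_apply_right, Equiv.swap_apply_of_ne_of_ne n₀₂.symm n₁₂.symm]
        rw [K.G_symm 1 0]
        abel
      simp [this]
    · have : K.act (Equiv.swap 1 2) K.top₃ - K.top₃ = K.d (K.G 0 1 * K.G 0 2) := by
        simp only [top₃, map_sub, map_mul, K.act_w, K.act_G, Equiv.swap_apply_left,
          Equiv.swap_apply_right, Equiv.swap_apply_of_ne_of_ne n₀₁ n₀₂]
        rw [K.G_symm 2 1, K.rel_p n₁₂, K.d_G_mul_G_zero_two]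
        abel
      exact this ▸ K.d_G_mul_G_mem_boundaries n₀₁ n₀₂
  | one => simp
  | mul σ τ _ _ hσ hτ =>
    have := Submodule.add_mem _ (K.act_mem_boundaries₃ σ hτ) hσ
    rwa [map_sub, sub_add_sub_cancel, ← AlgEquiv.mul_apply, ← map_mul] at this

theorem act_sub_mem_boundaries₃_zero_zero (K : KrizCP1 3 E) (σ : Equiv.Perm (Fin 3)) {x : E}
    (hx : x ∈ K.cocycles 0 0) : K.act σ x - x ∈ K.boundaries 0 0 := by
  obtain ⟨a, rfl⟩ := K.exists_coeff₃_zero_zero hx.1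
  simp

theorem act_sub_mem_boundaries₃_one_three (K : KrizCP1 3 E) (σ : Equiv.Perm (Fin 3)) {x : E}
    (hx : x ∈ K.cocycles 1 3) : K.act σ x - x ∈ K.boundaries 1 3 := by
  obtain ⟨c, hc⟩ := K.sub_smul_top₃_mem_boundaries hx
  have := Submodule.add_mem _ (Submodule.sub_mem _ (K.act_mem_boundaries₃ σ hc) hc)
    (Submodule.smul_mem _ c (K.act_top₃_sub_mem_boundaries σ))
  convert this using 1
  rw [map_sub, map_smul]
  module

end KrizCP1

/-- For the Križ model of `ℂP¹` with `n = 2` points, the only nonzero cohomology groups are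
`H_0^0` and `H_0^2`, each one-dimensional, and the nontrivial element of `S_2` acts on
`H_0^2` by `-1` (the sign representation).  For `n = 3`, the only nonzero cohomology groups
are `H_0^0` and `H_1^3`, each one-dimensional, with trivial `S_3`-action on both.
(In particular the Poincaré polynomials are `1 + t²` and `1 + st³`.) -/
theorem cp1_cohomology_two_and_three_points
    (E₂ : Type v) [Ring E₂] [Algebra ℚ E₂] (K₂ : KrizCP1 2 E₂)
    (E₃ : Type v) [Ring E₃] [Algebra ℚ E₃] (K₃ : KrizCP1 3 E₃) :
    -- `n = 2`
    (Module.finrank ℚ (K₂.H 0 0) = 1 ∧ Module.finrank ℚ (K₂.H 0 2) = 1 ∧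
      (∀ q k : ℕ, ¬(q = 0 ∧ k = 0) → ¬(q = 0 ∧ k = 2) → Subsingleton (K₂.H q k)) ∧
      -- the transposition acts by `-1` on `H_0^2`
      (∀ x ∈ K₂.cocycles 0 2,
        K₂.act (Equiv.swap 0 1) x + x ∈ K₂.boundaries 0 2)) ∧
    -- `n = 3`
    (Module.finrank ℚ (K₃.H 0 0) = 1 ∧ Module.finrank ℚ (K₃.H 1 3) = 1 ∧
      (∀ q k : ℕ, ¬(q = 0 ∧ k = 0) → ¬(q = 1 ∧ k = 3) → Subsingleton (K₃.H q k)) ∧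
      -- `S_3` acts trivially on `H_0^0` and on `H_1^3`
      (∀ σ : Equiv.Perm (Fin 3),
        (∀ x ∈ K₃.cocycles 0 0, K₃.act σ x - x ∈ K₃.boundaries 0 0) ∧
        (∀ x ∈ K₃.cocycles 1 3, K₃.act σ x - x ∈ K₃.boundaries 1 3))) := by
  exact ⟨⟨K₂.finrank_H₂_zero_zero, K₂.finrank_H₂_zero_two, K₂.subsingleton_H₂,
      fun _ hx => K₂.act_swap_add_mem_boundaries hx⟩,
    K₃.finrank_H₃_zero_zero, K₃.finrank_H₃_one_three, K₃.subsingleton_H₃,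
    fun σ => ⟨fun _ hx => K₃.act_sub_mem_boundaries₃_zero_zero σ hx,
      fun _ hx => K₃.act_sub_mem_boundaries₃_one_three σ hx⟩⟩
end
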